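/- Let s ∈ (1/2, 1) and let x ∈ (0,1) be irrational with regular continued fraction convergent denominators (Q_n)_{n≥0}. If Σ_{n=1}^{∞} Q_{n+1}^{(3−s)/2} / Q_n^{1+s/2} < ∞, then the series F_s(x) = Σ_{k=1}^{∞} e^{iπk²x}/k^s converges and F_s(x) = Σ_{j=0}^{∞} e^{(iπ/4) Σ_{ℓ=0}^{j−1} σ(T^ℓ(x))} (Π_{ℓ=0}^{j−1} |T^ℓ(x)|)^{s−1/2} Ω_s(T^j(x)) (empty products equal to 1 for j = 0). Moreover, the condition Σ_{n=1}^{∞} Q_{n+1}^{(3−s)/2} / Q_n^{1+s/2} < ∞ holds for every irrational x ∈ (0,1) whose irrationality exponent satisfies μ(x) < 1 + (2+s)/(3−s). -/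

import Mathlib

open Complex Filter Finset

noncomputable section

/-- `ρ = e^{iπ/4}`. -/
def ρ : ℂ := Complex.exp (Real.pi * Complex.I / 4)

/-- Partial sum `F_{s,n}(x,t) = Σ_{k=1}^{n} e^{iπk²x + 2πikt}/k^s`. -/
def Fpart (s : ℝ) (n : ℕ) (x t : ℝ) : ℂ :=
  ∑ k ∈ Finset.Icc 1 n,
    Complex.exp (Real.pi * Complex.I * (k : ℂ) ^ 2 * (x : ℂ)
        + 2 * Real.pi * Complex.I * (k : ℂ) * (t : ℂ)) / (k : ℂ) ^ (s : ℂ)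

/-- The function `I_s(x,t)` (for `x > 0`). -/
def Ifun (s x t : ℝ) : ℂ :=
  (∫ u : ℝ, ρ *
      (Complex.exp (Real.pi * Complex.I * ((1 : ℂ) / 2 + ρ * (u : ℂ)) ^ 2 * (x : ℂ)
            + 2 * Real.pi * Complex.I * ((1 : ℂ) / 2 + ρ * (u : ℂ)) * (Int.fract t : ℝ)) /
        (((1 : ℂ) / 2 + ρ * (u : ℂ)) ^ (s : ℂ) *
          (1 - Complex.exp (2 * Real.pi * Complex.I * ((1 : ℂ) / 2 + ρ * (u : ℂ)))))))
  + ρ * (x : ℂ) ^ (s : ℂ) *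
    ∫ u : ℝ, (Real.exp (-(Real.pi * x * u ^ 2)) : ℝ) *
      ∑' k : ℕ, Complex.exp (-(Real.pi * Complex.I * (((k : ℂ) + 1) - (Int.fract t : ℝ)) ^ 2 / (x : ℂ))) *
        (((ρ * (x : ℂ) * (u : ℂ) + ((k : ℂ) + 1) - (Int.fract t : ℝ)) ^ (s : ℂ))⁻¹
          - (((k : ℂ) + 1) ^ (s : ℂ))⁻¹)

/-- `Ω_s(x,t)`. -/
def Omega (s x t : ℝ) : ℂ :=
  if 0 < x then Ifun s x t else (starRingEnd ℂ) (Ifun s (-x) (-t))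

/-- `Ω_s(x) = Ω_s(x,0)`. -/
def Omega0 (s x : ℝ) : ℂ := Omega s x 0

/-- The map `T(x) = -1/x mod 2`, valued in `(-1,1]`. -/
def Tmap (x : ℝ) : ℝ := -1 / x - 2 * ⌈((-1 / x) - 1) / 2⌉

/-- Denominator `Q_n` of the `n`-th convergent of the regular continued fraction of `x`. -/
def Qden (x : ℝ) (n : ℕ) : ℝ := (GenContFract.of x).dens n

end

open scoped Topology

/-- Irrationality exponent of `x`, as an extended real number. -/
noncomputable def irrExp (x : ℝ) : EReal :=
  sSup {m : EReal | ∃ μ : ℝ, m = (μ : EReal) ∧ 1 ≤ μ ∧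
    {q : ℕ | 1 ≤ q ∧ ∃ p : ℤ, |x - (p : ℝ) / (q : ℝ)| < 1 / (q : ℝ) ^ μ}.Infinite}

open MeasureTheory

/-- The point with parameter `u` on the line through `c` with direction `ρ`. -/
noncomputable def linePt (c u : ℝ) : ℂ := c + ρ * u

lemma rho_eq : ρ = ((√2 / 2 : ℝ) : ℂ) + ((√2 / 2 : ℝ) : ℂ) * I := by
  have h : (Real.pi : ℂ) * I / 4 = ((Real.pi / 4 : ℝ) : ℂ) * I := by push_cast; ring
  rw [ρ, h, exp_mul_I, ← ofReal_cos, ← ofReal_sin, Real.cos_pi_div_four, Real.sin_pi_div_four]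

lemma rho_re : ρ.re = √2 / 2 := by simp [rho_eq]

lemma rho_im : ρ.im = √2 / 2 := by simp [rho_eq]

lemma rho_sq : ρ * ρ = I := by
  have h : ((√2 : ℝ) : ℂ) * (√2 : ℝ) = 2 := by
    rw [← ofReal_mul, Real.mul_self_sqrt (by norm_num)]; norm_num
  rw [rho_eq]
  push_cast
  linear_combination (I / 2) * h + ((√2 : ℝ) : ℂ) * (√2 : ℝ) / 4 * I_sq

lemma norm_rho : ‖ρ‖ = 1 := by
  have h : (Real.pi : ℂ) * I / 4 = ((Real.pi / 4 : ℝ) : ℂ) * I := by push_cast; ring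
  rw [ρ, h, norm_exp_ofReal_mul_I]

lemma linePt_re (c u : ℝ) : (linePt c u).re = c + √2 / 2 * u := by
  simp [linePt, rho_re]

lemma linePt_im (c u : ℝ) : (linePt c u).im = √2 / 2 * u := by
  simp [linePt, rho_im]

lemma continuous_linePt (c : ℝ) : Continuous (linePt c) := by
  unfold linePt; fun_prop

lemma half_le_norm_linePt (c u : ℝ) : c / 2 ≤ ‖linePt c u‖ := by
  refine le_of_sq_le_sq ?_ (norm_nonneg _)
  rw [← normSq_eq_norm_sq, normSq_apply, linePt_re, linePt_im]
  have h2 : √2 * √2 = 2 := Real.mul_self_sqrt (by norm_num)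
  nlinarith [sq_nonneg (c + √2 * u), sq_nonneg c, sq_nonneg u]

lemma linePt_mem_slitPlane {c : ℝ} (hc : 0 < c) (u : ℝ) : linePt c u ∈ slitPlane := by
  rw [mem_slitPlane_iff, linePt_re, linePt_im]
  rcases eq_or_ne u 0 with h | h
  · left; simpa [h]
  · right; positivity

lemma linePt_ne_zero {c : ℝ} (hc : 0 < c) (u : ℝ) : linePt c u ≠ 0 :=
  slitPlane_ne_zero (linePt_mem_slitPlane hc u)

lemma rho_mul_eq_linePt (v y : ℝ) : ρ * (v + y * I) = linePt (-(√2 * y)) (v + y) := by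
  have h : ((√2 : ℝ) : ℂ) * (√2 : ℝ) = 2 := by
    rw [← ofReal_mul, Real.mul_self_sqrt (by norm_num)]; norm_num
  rw [linePt, rho_eq]
  push_cast
  linear_combination ((√2 : ℝ) : ℂ) / 2 * y * I_sq

/-- A continuous function on `ℝ` with Gaussian decay is integrable. -/
lemma integrable_of_gaussian_decay {g : ℝ → ℂ} (hg : Continuous g) {ε M V : ℝ} (hε : 0 < ε)
    (hb : ∀ u, V ≤ |u| → ‖g u‖ ≤ M * Real.exp (-ε * u ^ 2)) : Integrable g := by
  refine hg.locallyIntegrable.integrable_of_isBigO_cocompact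
    (g := fun u : ℝ => Real.exp (-ε * u ^ 2)) ?_
    ((integrable_exp_neg_mul_sq hε).integrableAtFilter _)
  refine Asymptotics.IsBigO.of_bound M ?_
  have : ∀ᶠ u : ℝ in cocompact ℝ, V ≤ |u| :=
    (tendsto_norm_cocompact_atTop (E := ℝ)).eventually_ge_atTop V
  filter_upwards [this] with u hu
  rw [Real.norm_eq_abs, Real.abs_exp]
  exact hb u hu

/-- Cauchy's theorem for the strip between two lines of direction `ρ`. -/
lemma integral_linePt_eq_of_differentiableOn {Φ : ℂ → ℂ} {c₁ c₂ ε M V : ℝ} (hc : c₁ ≤ c₂)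
    (hε : 0 < ε) (hd : DifferentiableOn ℂ Φ {z | ∃ c ∈ Set.Icc c₁ c₂, ∃ u : ℝ, z = linePt c u})
    (hb : ∀ c ∈ Set.Icc c₁ c₂, ∀ u : ℝ, V ≤ |u| →
      ‖Φ (linePt c u)‖ ≤ M * Real.exp (-ε * u ^ 2)) :
    ∫ u : ℝ, Φ (linePt c₁ u) = ∫ u : ℝ, Φ (linePt c₂ u) := by
  have s2 : 0 < √2 := by positivity
  have h2 : √2 * √2 = 2 := Real.mul_self_sqrt (by norm_num)
  have hint : ∀ c ∈ Set.Icc c₁ c₂, Integrable fun u => Φ (linePt c u) := fun c hcm =>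
    integrable_of_gaussian_decay
      (hd.continuousOn.comp_continuous (continuous_linePt c) fun u => ⟨c, hcm, u, rfl⟩) hε (hb c hcm)
  set y₁ := -c₂ / √2 with hy₁
  set y₂ := -c₁ / √2 with hy₂
  have e₁ : -(√2 * y₁) = c₂ := by rw [hy₁]; field_simp
  have e₂ : -(√2 * y₂) = c₁ := by rw [hy₂]; field_simp
  have h12 : y₁ ≤ y₂ := by rw [hy₁, hy₂]; gcongr
  have hmem : ∀ y ∈ Set.Icc y₁ y₂, -(√2 * y) ∈ Set.Icc c₁ c₂ := fun y hy =>
    ⟨by rw [← e₂]; nlinarith [hy.2], by rw [← e₁]; nlinarith [hy.1]⟩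
  set G : ℂ → ℂ := fun w => Φ (ρ * w) with hG
  have hGl : ∀ v y : ℝ, G (v + y * I) = Φ (linePt (-(√2 * y)) (v + y)) := fun v y => by
    simp only [hG, rho_mul_eq_linePt]
  have hGint : ∀ y ∈ Set.Icc y₁ y₂, Integrable fun v : ℝ => G (v + y * I) := fun y hy => by
    simp only [hGl]
    exact (hint _ (hmem y hy)).comp_add_right y
  have hGval : ∀ y : ℝ, ∫ v : ℝ, G (v + y * I) = ∫ u, Φ (linePt (-(√2 * y)) u) := fun y => by
    simp only [hGl]
    exact integral_add_right_eq_self (fun u => Φ (linePt (-(√2 * y)) u)) y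
  have hGd : ∀ R : ℝ, DifferentiableOn ℂ G (Set.uIcc (-R) R ×ℂ Set.uIcc y₁ y₂) := fun R => by
    refine hd.comp (by fun_prop) fun w hw => ?_
    rw [mem_reProdIm, Set.uIcc_of_le h12] at hw
    exact ⟨_, hmem _ hw.2, w.re + w.im, by rw [← rho_mul_eq_linePt, re_add_im]⟩
  have hrect : ∀ R : ℝ, (∫ v : ℝ in (-R)..R, G (v + y₁ * I)) - (∫ v : ℝ in (-R)..R, G (v + y₂ * I))
      = I • (∫ y : ℝ in y₁..y₂, G ((-R : ℝ) + y * I)) - I • ∫ y : ℝ in y₁..y₂, G (R + y * I) := by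
    intro R
    have := integral_boundary_rect_eq_zero_of_differentiableOn G ⟨-R, y₁⟩ ⟨R, y₂⟩ (hGd R)
    simp only at this
    linear_combination this
  have hside : ∀ σ : ℝ, |σ| = 1 →
      Tendsto (fun R : ℝ => ∫ y : ℝ in y₁..y₂, G ((σ * R : ℝ) + y * I)) atTop (𝓝 0) := by
    intro σ hσ
    set B := max |y₁| |y₂| with hB
    have hlim : Tendsto (fun R : ℝ => |M| * Real.exp (-ε * (R - B) ^ 2) * |y₂ - y₁|) atTop (𝓝 0) := by
      have : Tendsto (fun R : ℝ => -ε * (R - B) ^ 2) atTop atBot := by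
        apply Tendsto.const_mul_atTop_of_neg (by linarith)
        exact (tendsto_pow_atTop two_ne_zero).comp (tendsto_atTop_add_const_right _ _ tendsto_id)
      simpa using ((Real.tendsto_exp_atBot.comp this).const_mul |M|).mul_const |y₂ - y₁|
    refine squeeze_zero_norm' ?_ hlim
    filter_upwards [eventually_ge_atTop (|V| + B + 1)] with R hR
    refine intervalIntegral.norm_integral_le_of_norm_le_const fun y hy => ?_
    rw [Set.uIoc_of_le h12] at hy
    have hy' : y ∈ Set.Icc y₁ y₂ := ⟨hy.1.le, hy.2⟩
    have hyB : |y| ≤ B := abs_le_max_abs_abs hy'.1 hy'.2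
    have hB0 : 0 ≤ B := (abs_nonneg y).trans hyB
    have hV := abs_nonneg V
    have hR0 : 0 ≤ R := by linarith
    have habs : R - B ≤ |σ * R + y| := by
      have h1 : |σ * R| = R := by rw [abs_mul, hσ, one_mul, abs_of_nonneg hR0]
      have := abs_sub_abs_le_abs_sub (σ * R) (-y)
      rw [abs_neg, sub_neg_eq_add, h1] at this
      linarith
    rw [hGl]
    refine (hb _ (hmem y hy') _ (by linarith [le_abs_self V])).trans ?_
    refine mul_le_mul (le_abs_self M) (Real.exp_le_exp.2 ?_) (Real.exp_pos _).le (abs_nonneg M)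
    have : (R - B) ^ 2 ≤ (σ * R + y) ^ 2 := by
      rw [← sq_abs (σ * R + y)]
      exact pow_le_pow_left₀ (by linarith) habs 2
    nlinarith
  have hL : Tendsto (fun R : ℝ => (∫ v : ℝ in (-R)..R, G (v + y₁ * I))
      - (∫ v : ℝ in (-R)..R, G (v + y₂ * I))) atTop
      (𝓝 ((∫ v : ℝ, G (v + y₁ * I)) - ∫ v : ℝ, G (v + y₂ * I))) :=
    (intervalIntegral_tendsto_integral (hGint y₁ ⟨le_rfl, h12⟩) tendsto_neg_atTop_atBot tendsto_id).sub
      (intervalIntegral_tendsto_integral (hGint y₂ ⟨h12, le_rfl⟩) tendsto_neg_atTop_atBot tendsto_id)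
  have hR0 : Tendsto (fun R : ℝ => I • (∫ y : ℝ in y₁..y₂, G ((-R : ℝ) + y * I))
      - I • ∫ y : ℝ in y₁..y₂, G (R + y * I)) atTop (𝓝 0) := by
    have a := (hside (-1) (by norm_num)).const_smul I
    have b := (hside 1 (by norm_num)).const_smul I
    simpa using a.sub b
  have := tendsto_nhds_unique hL (by simpa only [hrect] using hR0)
  rw [hGval, hGval, e₁, e₂] at this
  exact (sub_eq_zero.1 this).symm

/-- The summand `e^{iπz²x}z^{-s}` multiplied by the character `e^{-2πikz}`. -/
noncomputable def twistedTerm (s x : ℝ) (k : ℕ) (z : ℂ) : ℂ :=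
  exp (Real.pi * I * z ^ 2 * x - 2 * Real.pi * I * k * z) * (z ^ (s : ℂ))⁻¹

/-- The denominator `1 - e^{2πiz}`. -/
noncomputable def poleDen (z : ℂ) : ℂ := 1 - exp (2 * Real.pi * I * z)

/-- An entire function with `g 0 = 1` and `g w - g (w + 1) = g w * (1 - e^{2πiw})`. -/
noncomputable def poleGauss (w : ℂ) : ℂ := exp (Real.pi * I * (w ^ 2 + w))

lemma linePt_sq (c u : ℝ) : linePt c u ^ 2 = c ^ 2 + 2 * c * ρ * u + I * u ^ 2 := by
  rw [linePt]; linear_combination (u : ℂ) ^ 2 * rho_sq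

lemma linePt_sq_im (c u : ℝ) : (linePt c u ^ 2).im = √2 * c * u + u ^ 2 := by
  rw [pow_two, mul_im, linePt_re, linePt_im]
  have h2 : √2 * √2 = 2 := Real.mul_self_sqrt (by norm_num)
  linear_combination u ^ 2 / 2 * h2

lemma re_pi_I_mul (z : ℂ) (a : ℝ) : (a * I * z).re = -(a * z.im) := by
  simp

lemma norm_exp_sub_linePt (x : ℝ) (k : ℕ) (c u : ℝ) :
    ‖exp (Real.pi * I * linePt c u ^ 2 * x - 2 * Real.pi * I * k * linePt c u)‖
      = Real.exp (-(Real.pi * x) * u ^ 2 + √2 * Real.pi * u * (k - c * x)) := by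
  have h : Real.pi * I * linePt c u ^ 2 * x - 2 * Real.pi * I * k * linePt c u
      = ((Real.pi * x : ℝ) : ℂ) * I * linePt c u ^ 2
        + ((-(2 * Real.pi * k) : ℝ) : ℂ) * I * linePt c u := by
    push_cast; ring
  rw [norm_exp, h, add_re, re_pi_I_mul, re_pi_I_mul, linePt_sq_im, linePt_im]
  congr 1; ring

lemma norm_cpow_inv_linePt_le {s c : ℝ} (hs : 0 ≤ s) (hc : 0 < c) (u : ℝ) :
    ‖(linePt c u ^ (s : ℂ))⁻¹‖ ≤ ((c / 2) ^ s)⁻¹ := by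
  rw [norm_inv, norm_cpow_real]
  have := half_le_norm_linePt c u
  gcongr

lemma norm_twistedTerm_le {s c : ℝ} (hs : 0 ≤ s) (hc : 0 < c) (x : ℝ) (k : ℕ) (u : ℝ) :
    ‖twistedTerm s x k (linePt c u)‖ ≤
      Real.exp (-(Real.pi * x) * u ^ 2 + √2 * Real.pi * u * (k - c * x)) * ((c / 2) ^ s)⁻¹ := by
  rw [twistedTerm, norm_mul, norm_exp_sub_linePt]
  gcongr
  exact norm_cpow_inv_linePt_le hs hc u

lemma neg_sq_add_le {a lam : ℝ} (ha : 0 < a) (u : ℝ) :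
    -a * u ^ 2 + lam * |u| ≤ -(a / 2) * u ^ 2 + lam ^ 2 / (2 * a) := by
  have h : lam ^ 2 / (2 * a) + a / 2 * u ^ 2 - lam * |u| = (lam - a * |u|) ^ 2 / (2 * a) := by
    rw [← sq_abs u]; field_simp; ring
  have : 0 ≤ (lam - a * |u|) ^ 2 / (2 * a) := by positivity
  linarith

lemma norm_twistedTerm_le_gaussian {s c₁ c₂ x : ℝ} (hs : 0 ≤ s) (hc₁ : 0 < c₁) (hx : 0 < x)
    (k : ℕ) : ∃ M : ℝ, ∀ c ∈ Set.Icc c₁ c₂, ∀ u : ℝ,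
      ‖twistedTerm s x k (linePt c u)‖ ≤ M * Real.exp (-(Real.pi * x / 2) * u ^ 2) := by
  have hpi := Real.pi_pos
  set lam := √2 * Real.pi * (k + c₂ * x) with hlam
  refine ⟨Real.exp (lam ^ 2 / (2 * (Real.pi * x))) * ((c₁ / 2) ^ s)⁻¹, fun c hc u => ?_⟩
  have hc0 : 0 < c := hc₁.trans_le hc.1
  refine (norm_twistedTerm_le hs hc0 x k u).trans ?_
  have h1 : ((c / 2) ^ s)⁻¹ ≤ ((c₁ / 2) ^ s)⁻¹ := by
    have := hc.1
    gcongr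
  have h2 : Real.exp (-(Real.pi * x) * u ^ 2 + √2 * Real.pi * u * (k - c * x)) ≤
      Real.exp (lam ^ 2 / (2 * (Real.pi * x))) * Real.exp (-(Real.pi * x / 2) * u ^ 2) := by
    rw [← Real.exp_add]
    apply Real.exp_le_exp.2
    have h3 := neg_sq_add_le (a := Real.pi * x) (lam := lam) (by positivity) u
    have h4 : √2 * Real.pi * u * (k - c * x) ≤ lam * |u| := by
      have : |(k : ℝ) - c * x| ≤ k + c₂ * x := by
        rw [abs_le]
        have : (0 : ℝ) ≤ k := k.cast_nonneg
        constructor <;> nlinarith [hc.2]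
      calc √2 * Real.pi * u * (k - c * x) ≤ |√2 * Real.pi * u * (k - c * x)| := le_abs_self _
        _ = √2 * Real.pi * |u| * |(k : ℝ) - c * x| := by
          rw [abs_mul, abs_mul, abs_of_pos (show 0 < √2 * Real.pi by positivity)]
        _ ≤ √2 * Real.pi * |u| * (k + c₂ * x) := by gcongr
        _ = lam * |u| := by rw [hlam]; ring
    linarith
  calc _ ≤ (Real.exp (lam ^ 2 / (2 * (Real.pi * x))) * Real.exp (-(Real.pi * x / 2) * u ^ 2)) *
        ((c₁ / 2) ^ s)⁻¹ := by gcongr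
    _ = _ := by ring

lemma norm_exp_two_pi_linePt (c u : ℝ) :
    ‖exp (2 * Real.pi * I * linePt c u)‖ = Real.exp (-(√2 * Real.pi * u)) := by
  have h : 2 * Real.pi * I * linePt c u = ((2 * Real.pi : ℝ) : ℂ) * I * linePt c u := by
    push_cast; ring
  rw [norm_exp, h, re_pi_I_mul, linePt_im]
  congr 1; ring

lemma max_le_abs_one_sub_exp {r : ℝ} (hr : 1 ≤ |r|) :
    max 1 (Real.exp (-r)) ≤ 2 * |1 - Real.exp (-r)| := by
  have he : 2 ≤ Real.exp 1 := by linarith [Real.add_one_le_exp (1 : ℝ)]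
  rcases le_abs'.1 hr with h | h
  · have h1 : 2 ≤ Real.exp (-r) := he.trans (Real.exp_le_exp.2 (by linarith))
    rw [abs_of_nonpos (by linarith)]
    exact max_le (by linarith) (by linarith)
  · have h1 : Real.exp (-r) ≤ 1 / 2 := by
      rw [Real.exp_neg, ← one_div]
      apply one_div_le_one_div_of_le (by norm_num)
      exact he.trans (Real.exp_le_exp.2 (by linarith))
    rw [abs_of_nonneg (by linarith)]
    exact max_le (by linarith) (by linarith)

lemma max_le_norm_poleDen_of_large {c u : ℝ} (hu : 1 ≤ |√2 * Real.pi * u|) :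
    max 1 (Real.exp (-(√2 * Real.pi * u))) ≤ 2 * ‖poleDen (linePt c u)‖ := by
  refine (max_le_abs_one_sub_exp hu).trans ?_
  gcongr
  rw [poleDen, ← norm_exp_two_pi_linePt c u]
  simpa using abs_norm_sub_norm_le (1 : ℂ) (exp (2 * Real.pi * I * linePt c u))

lemma exp_two_pi_linePt_half (N : ℕ) (u : ℝ) :
    exp (2 * Real.pi * I * linePt (N + 1 / 2) u)
      = -((Real.exp (-(√2 * Real.pi * u)) : ℝ) * exp ((√2 * Real.pi * u : ℝ) * I)) := by
  have h : 2 * Real.pi * I * linePt (N + 1 / 2) u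
      = (N * (2 * Real.pi * I) + Real.pi * I)
        + (((-(√2 * Real.pi * u) : ℝ) : ℂ) + (√2 * Real.pi * u : ℝ) * I) := by
    rw [linePt, rho_eq]; push_cast
    linear_combination (√2 : ℝ) * Real.pi * u * I_sq
  rw [h, exp_add, exp_add, exp_add, exp_nat_mul_two_pi_mul_I, exp_pi_mul_I, ofReal_exp]
  ring

lemma max_le_norm_poleDen_half (N : ℕ) (u : ℝ) :
    max 1 (Real.exp (-(√2 * Real.pi * u))) ≤ 2 * ‖poleDen (linePt (N + 1 / 2) u)‖ := by
  rcases le_total 1 |√2 * Real.pi * u| with h | h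
  · exact max_le_norm_poleDen_of_large h
  set r := √2 * Real.pi * u with hr
  have hpi := Real.pi_gt_three
  have hcos : 0 ≤ Real.cos r := Real.cos_nonneg_of_neg_pi_div_two_le_of_le
    (by linarith [(abs_le.1 h).1]) (by linarith [(abs_le.1 h).2])
  have he := Real.exp_pos (-r)
  have hkey : poleDen (linePt (N + 1 / 2) u) = ((1 + Real.exp (-r) * Real.cos r : ℝ) : ℂ)
      + ((Real.exp (-r) * Real.sin r : ℝ) : ℂ) * I := by
    rw [poleDen, exp_two_pi_linePt_half, ← hr, exp_mul_I, ← ofReal_cos, ← ofReal_sin]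
    push_cast; ring
  have hsq : ‖poleDen (linePt (N + 1 / 2) u)‖ ^ 2
      = 1 + 2 * Real.exp (-r) * Real.cos r + Real.exp (-r) ^ 2 := by
    rw [← normSq_eq_norm_sq, hkey, normSq_add_mul_I]
    linear_combination Real.exp (-r) ^ 2 * Real.sin_sq_add_cos_sq r
  have hn := norm_nonneg (poleDen (linePt (N + 1 / 2) u))
  have hec : 0 ≤ 2 * Real.exp (-r) * Real.cos r := by positivity
  have h1 : 1 ≤ ‖poleDen (linePt (N + 1 / 2) u)‖ :=
    le_of_sq_le_sq (by rw [hsq]; nlinarith) hn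
  have h2 : Real.exp (-r) ≤ ‖poleDen (linePt (N + 1 / 2) u)‖ :=
    le_of_sq_le_sq (by rw [hsq]; nlinarith) hn
  exact max_le (by linarith) (by linarith)

lemma poleDen_ne_zero_half (N : ℕ) (u : ℝ) : poleDen (linePt (N + 1 / 2) u) ≠ 0 := by
  rw [← norm_ne_zero_iff]
  have := (le_max_left 1 _).trans (max_le_norm_poleDen_half N u)
  intro h
  rw [h] at this
  norm_num at this

lemma poleDen_eq_zero_iff (z : ℂ) : poleDen z = 0 ↔ ∃ n : ℤ, z = n := by
  rw [poleDen, sub_eq_zero, eq_comm, exp_eq_one_iff]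
  refine exists_congr fun n => ?_
  rw [show (n : ℂ) * (2 * Real.pi * I) = 2 * Real.pi * I * n by ring]
  exact mul_right_inj' two_pi_I_ne_zero

lemma differentiable_poleDen : Differentiable ℂ poleDen := by
  unfold poleDen; fun_prop

lemma differentiableOn_twistedTerm (s x : ℝ) (k : ℕ) :
    DifferentiableOn ℂ (twistedTerm s x k) slitPlane := by
  intro z hz
  unfold twistedTerm
  refine DifferentiableAt.differentiableWithinAt (DifferentiableAt.mul (by fun_prop) ?_)
  refine DifferentiableAt.inv (differentiableAt_id.cpow (differentiableAt_const _) hz) ?_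
  simp [cpow_eq_zero_iff, slitPlane_ne_zero hz]

lemma continuous_twistedTerm_linePt (s x : ℝ) (k : ℕ) {c : ℝ} (hc : 0 < c) :
    Continuous fun u => twistedTerm s x k (linePt c u) :=
  (differentiableOn_twistedTerm s x k).continuousOn.comp_continuous (continuous_linePt c)
    fun u => linePt_mem_slitPlane hc u

lemma integrable_twistedTerm {s x c : ℝ} (hs : 0 ≤ s) (hx : 0 < x) (hc : 0 < c) (k : ℕ) :
    Integrable fun u => twistedTerm s x k (linePt c u) := by
  obtain ⟨M, hM⟩ := norm_twistedTerm_le_gaussian (c₂ := c) hs hc hx k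
  have hpi := Real.pi_pos
  exact integrable_of_gaussian_decay (V := 0) (continuous_twistedTerm_linePt s x k hc)
    (by positivity) fun u _ => hM c ⟨le_rfl, le_rfl⟩ u

lemma integrable_twistedTerm_div {s x : ℝ} (hs : 0 ≤ s) (hx : 0 < x) (k N : ℕ) :
    Integrable fun u => twistedTerm s x k (linePt (N + 1 / 2) u) / poleDen (linePt (N + 1 / 2) u) := by
  have hc : (0 : ℝ) < N + 1 / 2 := by positivity
  obtain ⟨M, hM⟩ := norm_twistedTerm_le_gaussian (c₂ := N + 1 / 2) hs hc hx k
  have hpi := Real.pi_pos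
  refine integrable_of_gaussian_decay (V := 0) (M := 2 * M) (ε := Real.pi * x / 2)
    ((continuous_twistedTerm_linePt s x k hc).div
      (differentiable_poleDen.continuous.comp (continuous_linePt _)) (poleDen_ne_zero_half N))
    (by positivity) fun u _ => ?_
  have h1 := (le_max_left 1 _).trans (max_le_norm_poleDen_half N u)
  have h2 := hM _ ⟨le_rfl, le_rfl⟩ u
  rw [norm_div, div_le_iff₀ (by linarith)]
  have h3 := (norm_nonneg _).trans h2
  nlinarith

/-- Shifting the line of integration for a single twisted term. -/
lemma integral_twistedTerm_shift {s x c₁ c₂ : ℝ} (hs : 0 ≤ s) (hx : 0 < x) (hc₁ : 0 < c₁)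
    (hc : c₁ ≤ c₂) (k : ℕ) :
    ∫ u : ℝ, twistedTerm s x k (linePt c₁ u) = ∫ u : ℝ, twistedTerm s x k (linePt c₂ u) := by
  obtain ⟨M, hM⟩ := norm_twistedTerm_le_gaussian (c₂ := c₂) hs hc₁ hx k
  have hpi := Real.pi_pos
  refine integral_linePt_eq_of_differentiableOn (V := 0) (ε := Real.pi * x / 2) hc (by positivity)
    ((differentiableOn_twistedTerm s x k).mono ?_) fun c hc u _ => hM c hc u
  rintro _ ⟨c, hcm, u, rfl⟩
  exact linePt_mem_slitPlane (hc₁.trans_le hcm.1) u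

lemma norm_poleGauss_linePt (c u : ℝ) : ‖poleGauss (linePt c u)‖
    = Real.exp (-Real.pi * u ^ 2 - √2 * Real.pi * u * (c + 1 / 2)) := by
  rw [poleGauss, norm_exp, re_pi_I_mul, add_im, linePt_sq_im, linePt_im]
  congr 1; ring

lemma norm_poleGauss_linePt_le {c : ℝ} (hc : |c + 1 / 2| ≤ 1) (u : ℝ) :
    ‖poleGauss (linePt c u)‖ ≤ Real.exp Real.pi * Real.exp (-(Real.pi / 2) * u ^ 2) := by
  rw [norm_poleGauss_linePt, ← Real.exp_add]
  apply Real.exp_le_exp.2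
  have hpi := Real.pi_pos
  have h := neg_sq_add_le (lam := √2 * Real.pi) hpi u
  have h2 : √2 * √2 = 2 := Real.mul_self_sqrt (by norm_num)
  have h3 : (√2 * Real.pi) ^ 2 / (2 * Real.pi) = Real.pi := by
    rw [mul_pow, pow_two √2, h2]; field_simp
  have h4 : -(√2 * Real.pi * u * (c + 1 / 2)) ≤ √2 * Real.pi * |u| := by
    calc _ ≤ |√2 * Real.pi * u * (c + 1 / 2)| := neg_le_abs _
      _ = √2 * Real.pi * |u| * |c + 1 / 2| := by
        rw [abs_mul, abs_mul, abs_of_pos (show 0 < √2 * Real.pi by positivity)]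
      _ ≤ √2 * Real.pi * |u| * 1 := by gcongr
      _ = _ := mul_one _
  linarith

lemma differentiable_poleGauss : Differentiable ℂ poleGauss := by
  unfold poleGauss; fun_prop

lemma poleDen_add_one (z : ℂ) : poleDen (z + 1) = poleDen z := by
  rw [poleDen, poleDen, mul_add, mul_one, exp_add, exp_two_pi_mul_I, mul_one]

lemma poleDen_sub_natCast (z : ℂ) (m : ℕ) : poleDen (z - m) = poleDen z := by
  induction m with
  | zero => simp
  | succ m ih => rw [← ih, ← poleDen_add_one (z - (m + 1 : ℕ))]; push_cast; ring_nf

lemma poleGauss_sub_add_one (w : ℂ) : poleGauss w - poleGauss (w + 1) = poleGauss w * poleDen w := by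
  have h : Real.pi * I * ((w + 1) ^ 2 + (w + 1))
      = Real.pi * I * (w ^ 2 + w) + 2 * Real.pi * I * w + 2 * Real.pi * I := by ring
  rw [poleGauss, poleGauss, poleDen, h, exp_add, exp_add, exp_two_pi_mul_I]
  ring

lemma linePt_sub_natCast (c u : ℝ) (m : ℕ) : linePt c u - m = linePt (c - m) u := by
  simp [linePt]; ring

lemma linePt_add_one (c u : ℝ) : linePt c u + 1 = linePt (c + 1) u := by
  simp [linePt]; ring

lemma rho_mul_exp_neg : ρ * exp (-(Real.pi * I / 4)) = 1 := by
  rw [ρ, ← exp_add]; simp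

lemma integral_poleGauss : ∫ u : ℝ, ρ * poleGauss (linePt (-(1 / 2)) u) = 1 := by
  have h : ∀ u : ℝ, ρ * poleGauss (linePt (-(1 / 2)) u)
      = ((Real.exp (-Real.pi * u ^ 2) : ℝ) : ℂ) := fun u => by
    have h1 : Real.pi * I * (linePt (-(1 / 2)) u ^ 2 + linePt (-(1 / 2)) u)
        = ((-Real.pi * u ^ 2 : ℝ) : ℂ) + -(Real.pi * I / 4) := by
      rw [linePt_sq, linePt]; push_cast
      linear_combination (Real.pi : ℂ) * u ^ 2 * I_sq
    rw [poleGauss, h1, exp_add, ofReal_exp]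
    linear_combination exp ((-Real.pi * u ^ 2 : ℝ) : ℂ) * rho_mul_exp_neg
  simp_rw [h]
  rw [integral_complex_ofReal, integral_gaussian, div_self Real.pi_pos.ne']
  simp

lemma integrable_poleGauss_div {c : ℝ} (hc : |c + 1 / 2| ≤ 1)
    (hE : ∀ u, max 1 (Real.exp (-(√2 * Real.pi * u))) ≤ 2 * ‖poleDen (linePt c u)‖) :
    Integrable fun u => poleGauss (linePt c u) / poleDen (linePt c u) := by
  have h0 : ∀ u, 1 ≤ 2 * ‖poleDen (linePt c u)‖ := fun u => (le_max_left 1 _).trans (hE u)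
  have hpi := Real.pi_pos
  refine integrable_of_gaussian_decay (V := 0) (M := 2 * Real.exp Real.pi) (ε := Real.pi / 2)
    ((differentiable_poleGauss.continuous.comp (continuous_linePt _)).div
      (differentiable_poleDen.continuous.comp (continuous_linePt _)) fun u => ?_)
    (by positivity) fun u _ => ?_
  · have := h0 u
    rw [← norm_ne_zero_iff]
    intro h
    rw [h] at this
    norm_num at this
  · have h1 := h0 u
    have h2 := norm_poleGauss_linePt_le hc u
    rw [norm_div, div_le_iff₀ (by linarith)]
    have h3 := (norm_nonneg _).trans h2
    nlinarith

lemma max_le_norm_poleDen_sub (N : ℕ) (m : ℕ) (u : ℝ) :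
    max 1 (Real.exp (-(√2 * Real.pi * u))) ≤ 2 * ‖poleDen (linePt (N + 1 / 2 - m) u)‖ := by
  rw [← linePt_sub_natCast, poleDen_sub_natCast]
  exact max_le_norm_poleDen_half N u

/-- The numerator of the integrand with its residue at the integer `m` removed. -/
noncomputable def corrNum (s x : ℝ) (m : ℕ) (z : ℂ) : ℂ :=
  twistedTerm s x 0 z - twistedTerm s x 0 m * poleGauss (z - m)

/-- The integrand with its pole at `m` removed. -/
noncomputable def corrQuot (s x : ℝ) (m : ℕ) (z : ℂ) : ℂ :=
  dslope (corrNum s x m) m z / dslope poleDen m z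

lemma corrQuot_eq {s x : ℝ} {m : ℕ} {z : ℂ} (hz : z ≠ m) :
    corrQuot s x m z = corrNum s x m z / poleDen z := by
  have h1 : corrNum s x m m = 0 := by simp [corrNum, poleGauss]
  have h2 : poleDen m = 0 := (poleDen_eq_zero_iff _).2 ⟨m, by simp⟩
  rw [corrQuot, dslope_of_ne _ hz, dslope_of_ne _ hz, slope_def_field, slope_def_field, h1, h2,
    sub_zero, sub_zero, div_div_div_cancel_right₀ (sub_ne_zero.2 hz)]

lemma dslope_poleDen_ne_zero {m : ℕ} {z : ℂ} (hz : ∀ n : ℤ, z = n → n = m) :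
    dslope poleDen m z ≠ 0 := by
  rcases eq_or_ne z m with rfl | hne
  · have : HasDerivAt poleDen (-(exp (2 * Real.pi * I * m) * (2 * Real.pi * I * 1))) (m : ℂ) :=
      (((hasDerivAt_id (m : ℂ)).const_mul (2 * Real.pi * I)).cexp).const_sub 1
    rw [dslope_same, this.deriv]
    simp [exp_ne_zero]
  · have h2 : poleDen m = 0 := (poleDen_eq_zero_iff _).2 ⟨m, by simp⟩
    rw [dslope_of_ne _ hne, slope_def_field, h2, sub_zero]
    refine div_ne_zero (fun h => ?_) (sub_ne_zero.2 hne)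
    obtain ⟨n, hn⟩ := (poleDen_eq_zero_iff _).1 h
    exact hne (by rw [hn, hz n hn]; simp)

lemma linePt_eq_int {N : ℕ} {c u : ℝ} (hc : c ∈ Set.Icc (N + 1 / 2 : ℝ) (N + 1 + 1 / 2)) {n : ℤ}
    (h : linePt c u = n) : n = (N + 1 : ℕ) := by
  have him := congrArg im h
  have hre := congrArg re h
  rw [linePt_im, intCast_im] at him
  rw [linePt_re, him, intCast_re, add_zero] at hre
  rw [hre] at hc
  obtain ⟨h1, h2⟩ := hc
  have h3 : (N : ℤ) < n := by
    have : ((N : ℤ) : ℝ) < n := by push_cast; linarith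
    exact_mod_cast this
  have h4 : n < (N : ℤ) + 2 := by
    have : (n : ℝ) < ((N : ℤ) + 2 : ℤ) := by push_cast; linarith
    exact_mod_cast this
  push_cast
  omega

lemma integral_corrQuot_shift {s x : ℝ} (hs : 0 ≤ s) (hx : 0 < x) (N : ℕ) :
    ∫ u : ℝ, corrQuot s x (N + 1) (linePt (N + 1 / 2) u)
      = ∫ u : ℝ, corrQuot s x (N + 1) (linePt (N + 1 + 1 / 2) u) := by
  have hc₁ : (0 : ℝ) < N + 1 / 2 := by positivity
  have hpi := Real.pi_pos
  obtain ⟨M, hM⟩ := norm_twistedTerm_le_gaussian (c₂ := N + 1 + 1 / 2) hs hc₁ hx 0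
  set ε := min (Real.pi * x / 2) (Real.pi / 2) with hε
  set A := ‖twistedTerm s x 0 ((N + 1 : ℕ) : ℂ)‖ with hA
  have hmem : ((N + 1 : ℕ) : ℂ) ∈ slitPlane := by
    rw [mem_slitPlane_iff]; left; rw [natCast_re]; positivity
  refine integral_linePt_eq_of_differentiableOn (V := 1) (ε := ε)
    (M := 2 * (M + A * Real.exp Real.pi)) (by linarith) (by positivity) ?_ ?_
  · refine DifferentiableOn.div ?_ ?_ ?_
    · refine DifferentiableOn.mono (t := slitPlane) ?_ ?_
      · rw [differentiableOn_dslope (isOpen_slitPlane.mem_nhds hmem)]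
        refine (differentiableOn_twistedTerm s x 0).sub (Differentiable.differentiableOn ?_)
        exact (differentiable_poleGauss.comp (differentiable_id.sub_const _)).const_mul _
      · rintro _ ⟨c, hc, u, rfl⟩
        exact linePt_mem_slitPlane (hc₁.trans_le hc.1) u
    · refine DifferentiableOn.mono ?_ (Set.subset_univ _)
      rw [differentiableOn_dslope univ_mem]
      exact differentiable_poleDen.differentiableOn
    · rintro _ ⟨c, hc, u, rfl⟩
      exact dslope_poleDen_ne_zero fun n hn => linePt_eq_int hc hn
  · intro c hc u hu
    have hs2 : 1 ≤ √2 := Real.one_le_sqrt.2 (by norm_num)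
    have hr : 1 ≤ |√2 * Real.pi * u| := by
      rw [abs_mul, abs_of_pos (show 0 < √2 * Real.pi by positivity)]
      have : 1 ≤ √2 * Real.pi := by nlinarith [Real.pi_gt_three]
      nlinarith
    have h1 := (le_max_left 1 _).trans (max_le_norm_poleDen_of_large (c := c) hr)
    have hne : linePt c u ≠ ((N + 1 : ℕ) : ℂ) := by
      intro h
      have := congrArg im h
      rw [linePt_im, natCast_im] at this
      have hu0 : u = 0 := by
        rcases mul_eq_zero.1 this with h | h
        · linarith
        · exact h
      rw [hu0] at hu
      norm_num at hu
    have hN : ‖corrNum s x (N + 1) (linePt c u)‖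
        ≤ (M + A * Real.exp Real.pi) * Real.exp (-ε * u ^ 2) := by
      have e1 : Real.exp (-(Real.pi * x / 2) * u ^ 2) ≤ Real.exp (-ε * u ^ 2) := by
        apply Real.exp_le_exp.2
        nlinarith [min_le_left (Real.pi * x / 2) (Real.pi / 2), sq_nonneg u]
      have e2 : Real.exp (-(Real.pi / 2) * u ^ 2) ≤ Real.exp (-ε * u ^ 2) := by
        apply Real.exp_le_exp.2
        nlinarith [min_le_right (Real.pi * x / 2) (Real.pi / 2), sq_nonneg u]
      have t1 := hM c hc u
      have hM0 : 0 ≤ M := by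
        have := (norm_nonneg _).trans t1
        exact nonneg_of_mul_nonneg_left this (Real.exp_pos _)
      have t2 := norm_poleGauss_linePt_le (c := c - (N + 1 : ℕ)) (by
        push_cast
        rw [abs_le]
        constructor <;> linarith [hc.1, hc.2]) u
      rw [corrNum, linePt_sub_natCast]
      refine (norm_sub_le _ _).trans ?_
      rw [norm_mul, ← hA]
      calc _ ≤ M * Real.exp (-ε * u ^ 2) + A * (Real.exp Real.pi * Real.exp (-ε * u ^ 2)) := by
            refine add_le_add (t1.trans (by gcongr)) ?_
            exact mul_le_mul_of_nonneg_left (t2.trans (by gcongr)) (norm_nonneg _)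
        _ = _ := by ring
    rw [corrQuot_eq hne, norm_div, div_le_iff₀ (by linarith)]
    have h3 := (norm_nonneg _).trans hN
    nlinarith

lemma linePt_half_ne_natCast (N m : ℕ) (u : ℝ) : linePt (N + 1 / 2) u ≠ m := fun h =>
  poleDen_ne_zero_half N u ((poleDen_eq_zero_iff _).2 ⟨m, by rw [h, Int.cast_natCast]⟩)

lemma integral_corrQuot {s x : ℝ} (hs : 0 ≤ s) (hx : 0 < x) (M m : ℕ)
    (hm : |(M + 1 / 2 : ℝ) - m + 1 / 2| ≤ 1) :
    ∫ u : ℝ, corrQuot s x m (linePt (M + 1 / 2) u)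
      = (∫ u : ℝ, twistedTerm s x 0 (linePt (M + 1 / 2) u) / poleDen (linePt (M + 1 / 2) u))
        - twistedTerm s x 0 m * ∫ u : ℝ, poleGauss (linePt (M + 1 / 2 - m) u)
            / poleDen (linePt (M + 1 / 2 - m) u) := by
  have h : ∀ u : ℝ, corrQuot s x m (linePt (M + 1 / 2) u)
      = twistedTerm s x 0 (linePt (M + 1 / 2) u) / poleDen (linePt (M + 1 / 2) u)
        - twistedTerm s x 0 m * (poleGauss (linePt (M + 1 / 2 - m) u)
            / poleDen (linePt (M + 1 / 2 - m) u)) := fun u => by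
    rw [corrQuot_eq (linePt_half_ne_natCast M m u), corrNum, ← linePt_sub_natCast,
      poleDen_sub_natCast]
    ring
  simp_rw [h]
  rw [integral_sub (integrable_twistedTerm_div hs hx 0 M)
    ((integrable_poleGauss_div hm (max_le_norm_poleDen_sub M m)).const_mul _),
    integral_const_mul]

/-- The remainder integral over the line through `N + 1/2`. -/
noncomputable def remInt (s x : ℝ) (k N : ℕ) : ℂ :=
  ∫ u : ℝ, ρ * (twistedTerm s x k (linePt (N + 1 / 2) u) / poleDen (linePt (N + 1 / 2) u))

lemma remInt_succ {s x : ℝ} (hs : 0 ≤ s) (hx : 0 < x) (N : ℕ) :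
    remInt s x 0 N - remInt s x 0 (N + 1) = twistedTerm s x 0 (N + 1 : ℕ) := by
  have h1 := integral_corrQuot hs hx N (N + 1) (by push_cast; rw [abs_le]; constructor <;> linarith)
  have h2 := integral_corrQuot hs hx (N + 1) (N + 1) (by
    push_cast; rw [abs_le]; constructor <;> linarith)
  have h3 := integral_corrQuot_shift hs hx N
  have ha : (N + 1 / 2 - (N + 1 : ℕ) : ℝ) = -(1 / 2) := by push_cast; ring
  have hb : ((N + 1 : ℕ) + 1 / 2 - (N + 1 : ℕ) : ℝ) = -(1 / 2) + 1 := by ring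
  have i1 := integrable_poleGauss_div (c := N + 1 / 2 - (N + 1 : ℕ)) (by
    rw [ha]; norm_num) (max_le_norm_poleDen_sub N (N + 1))
  have i2 := integrable_poleGauss_div (c := (N + 1 : ℕ) + 1 / 2 - (N + 1 : ℕ)) (by
    rw [hb]; norm_num) (max_le_norm_poleDen_sub (N + 1) (N + 1))
  have hE : ∀ u, poleDen (linePt (-(1 / 2)) u) ≠ 0 := fun u => by
    rw [← ha, ← linePt_sub_natCast, poleDen_sub_natCast]
    exact poleDen_ne_zero_half N u
  rw [ha] at h1 i1
  rw [hb] at h2 i2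
  have hg : ρ * ((∫ u : ℝ, poleGauss (linePt (-(1 / 2)) u) / poleDen (linePt (-(1 / 2)) u))
      - ∫ u : ℝ, poleGauss (linePt (-(1 / 2) + 1) u) / poleDen (linePt (-(1 / 2) + 1) u)) = 1 := by
    rw [← integral_sub i1 i2, ← integral_const_mul, ← integral_poleGauss]
    congr 1
    ext u
    rw [← linePt_add_one, poleDen_add_one, ← sub_div, poleGauss_sub_add_one,
      mul_div_cancel_right₀ _ (hE u)]
  have hcast : ((N + 1 : ℕ) : ℝ) + 1 / 2 = N + 1 + 1 / 2 := by push_cast; ring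
  rw [remInt, remInt, integral_const_mul, integral_const_mul]
  rw [hcast] at h2 ⊢
  rw [h1, h2] at h3
  linear_combination ρ * h3 + twistedTerm s x 0 (N + 1 : ℕ) * hg

lemma twistedTerm_natCast_zero (s x : ℝ) (n : ℕ) : twistedTerm s x 0 n
    = exp (Real.pi * I * (n : ℂ) ^ 2 * (x : ℂ) + 2 * Real.pi * I * (n : ℂ) * ((0 : ℝ) : ℂ))
      / (n : ℂ) ^ (s : ℂ) := by
  simp [twistedTerm, div_eq_mul_inv]

lemma Fpart_eq_remInt_sub {s x : ℝ} (hs : 0 ≤ s) (hx : 0 < x) (N : ℕ) :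
    Fpart s N x 0 = remInt s x 0 0 - remInt s x 0 N := by
  induction N with
  | zero => simp [Fpart]
  | succ N ih =>
    have h := remInt_succ hs hx N
    rw [twistedTerm_natCast_zero] at h
    rw [Fpart, Finset.sum_Icc_succ_top (by omega), ← Fpart, ih, ← h]
    ring

lemma remInt_succ_left {s x : ℝ} (hs : 0 ≤ s) (hx : 0 < x) (k N : ℕ) :
    remInt s x (k + 1) N = remInt s x k N
      + ∫ u : ℝ, ρ * twistedTerm s x (k + 1) (linePt (N + 1 / 2) u) := by
  have hc : (0 : ℝ) < N + 1 / 2 := by positivity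
  rw [remInt, remInt, ← integral_add ((integrable_twistedTerm_div hs hx k N).const_mul _)
    ((integrable_twistedTerm hs hx hc (k + 1)).const_mul _)]
  congr 1
  ext u
  have hE := poleDen_ne_zero_half N u
  set z := linePt (N + 1 / 2) u
  have h : Real.pi * I * z ^ 2 * x - 2 * Real.pi * I * k * z
      = (Real.pi * I * z ^ 2 * x - 2 * Real.pi * I * (k + 1 : ℕ) * z) + 2 * Real.pi * I * z := by
    push_cast; ring
  have h' : twistedTerm s x k z = twistedTerm s x (k + 1) z * (1 - poleDen z) := by
    rw [twistedTerm, twistedTerm, h, exp_add, poleDen]; ring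
  rw [h']
  field_simp
  ring

lemma norm_remInt_le {s x : ℝ} (hs : 0 ≤ s) (hs1 : s ≤ 1) (hx : 0 < x) (N : ℕ) :
    ‖remInt s x ⌊(N + 1 / 2) * x⌋₊ N‖ ≤ 4 * (((N : ℝ) + 1 / 2) ^ s)⁻¹ * (√x)⁻¹ := by
  set c : ℝ := N + 1 / 2 with hcdef
  have hc : 0 < c := by positivity
  have hpi := Real.pi_pos
  set k := ⌊c * x⌋₊ with hk
  have hk1 : (k : ℝ) ≤ c * x := Nat.floor_le (by positivity)
  have hk2 : c * x < k + 1 := Nat.lt_floor_add_one _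
  have hint : Integrable fun u : ℝ => 2 * ((c / 2) ^ s)⁻¹ * Real.exp (-(Real.pi * x) * u ^ 2) :=
    (integrable_exp_neg_mul_sq (by positivity)).const_mul _
  have hpt : ∀ u : ℝ, ‖ρ * (twistedTerm s x k (linePt c u) / poleDen (linePt c u))‖
      ≤ 2 * ((c / 2) ^ s)⁻¹ * Real.exp (-(Real.pi * x) * u ^ 2) := fun u => by
    have h1 : max 1 (Real.exp (-(√2 * Real.pi * u))) ≤ 2 * ‖poleDen (linePt c u)‖ :=
      max_le_norm_poleDen_half N u
    have hE : 0 < ‖poleDen (linePt c u)‖ := by linarith [(le_max_left 1 _).trans h1]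
    rw [norm_mul, norm_rho, one_mul, norm_div, div_le_iff₀ hE]
    refine (norm_twistedTerm_le hs hc x k u).trans ?_
    rw [Real.exp_add]
    have h2 : Real.exp (√2 * Real.pi * u * (k - c * x)) ≤ max 1 (Real.exp (-(√2 * Real.pi * u))) := by
      rcases le_total 0 u with hu | hu
      · refine le_max_of_le_left (Real.exp_le_one_iff.2 ?_)
        exact mul_nonpos_of_nonneg_of_nonpos (by positivity) (by linarith)
      · refine le_max_of_le_right (Real.exp_le_exp.2 ?_)
        have : √2 * Real.pi * u ≤ 0 := mul_nonpos_of_nonneg_of_nonpos (by positivity) hu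
        nlinarith
    calc _ ≤ Real.exp (-(Real.pi * x) * u ^ 2) * (2 * ‖poleDen (linePt c u)‖) * ((c / 2) ^ s)⁻¹ := by
          gcongr
          exact h2.trans h1
      _ = _ := by ring
  refine (norm_integral_le_of_norm_le hint (Eventually.of_forall hpt)).trans ?_
  rw [integral_const_mul, integral_gaussian, Real.div_rpow hc.le (by norm_num)]
  have h3 : Real.pi / (Real.pi * x) = x⁻¹ := by field_simp
  have h4 : (2 : ℝ) ^ s ≤ 2 := by
    simpa using Real.rpow_le_rpow_of_exponent_le (x := 2) (by norm_num) hs1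
  have h5 : 0 < c ^ s := Real.rpow_pos_of_pos hc s
  rw [h3, Real.sqrt_inv, inv_div]
  refine mul_le_mul_of_nonneg_right ?_ (by positivity)
  rw [div_eq_mul_inv, ← mul_assoc]
  exact mul_le_mul_of_nonneg_right (by linarith) (by positivity)

/-- The difference of `z^{-s}` at a point of the line through the integer `k` and at `k`. -/
noncomputable def cpowDiff (s : ℝ) (k y : ℝ) : ℂ :=
  (linePt k y ^ (s : ℂ))⁻¹ - ((k : ℂ) ^ (s : ℂ))⁻¹

lemma norm_cpowDiff_le {s k : ℝ} (hs : 0 ≤ s) (hs1 : s ≤ 1) (hk : 0 < k) (y : ℝ) :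
    ‖cpowDiff s k y‖ ≤ 4 * k ^ (-(s + 1)) * |y| := by
  have hder : ∀ t : ℝ, HasDerivAt (fun t : ℝ => linePt k t ^ (-(s : ℂ)))
      (-(s : ℂ) * linePt k t ^ (-(s : ℂ) - 1) * ρ) t := fun t => by
    have h1 : HasDerivAt (fun w : ℂ => (k : ℂ) + ρ * w) ρ (t : ℂ) := by
      simpa using ((hasDerivAt_id (t : ℂ)).const_mul ρ).const_add (k : ℂ)
    exact (h1.cpow_const (c := -(s : ℂ)) (linePt_mem_slitPlane hk t)).comp_ofReal
  have hbd : ∀ t : ℝ, ‖-(s : ℂ) * linePt k t ^ (-(s : ℂ) - 1) * ρ‖ ≤ 4 * k ^ (-(s + 1)) := fun t => by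
    have e : -(s : ℂ) - 1 = ((-(s + 1) : ℝ) : ℂ) := by push_cast; ring
    rw [norm_mul, norm_mul, norm_rho, mul_one, norm_neg, norm_real, Real.norm_of_nonneg hs, e,
      norm_cpow_real]
    have h1 : ‖linePt k t‖ ^ (-(s + 1)) ≤ (k / 2) ^ (-(s + 1)) :=
      Real.rpow_le_rpow_of_nonpos (by positivity) (half_le_norm_linePt k t) (by linarith)
    have h2 : (k / 2) ^ (-(s + 1)) ≤ 4 * k ^ (-(s + 1)) := by
      rw [div_eq_mul_inv, Real.mul_rpow hk.le (by norm_num), mul_comm]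
      refine mul_le_mul_of_nonneg_right ?_ (by positivity)
      rw [Real.inv_rpow (by norm_num), ← Real.rpow_neg (by norm_num), neg_neg]
      calc (2 : ℝ) ^ (s + 1) ≤ 2 ^ (2 : ℝ) :=
            Real.rpow_le_rpow_of_exponent_le (by norm_num) (by linarith)
        _ = 4 := by norm_num
    have h0 : 0 ≤ ‖linePt k t‖ ^ (-(s + 1)) := by positivity
    nlinarith
  have := Convex.norm_image_sub_le_of_norm_hasDerivWithin_le (s := Set.univ) (x := (0 : ℝ)) (y := y)
    (fun t _ => (hder t).hasDerivWithinAt) (fun t _ => hbd t) convex_univ trivial trivial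
  simp only [cpow_neg, sub_zero, Real.norm_eq_abs] at this
  have h0 : linePt k 0 = k := by simp [linePt]
  rwa [h0] at this

/-- The `k`-th summand (with index shifted by one) of the second integrand of `Ifun`. -/
noncomputable def corrTerm (s x : ℝ) (k : ℕ) (u : ℝ) : ℂ :=
  (Real.exp (-(Real.pi * x * u ^ 2)) : ℝ) *
    (exp (-(Real.pi * I * ((k : ℂ) + 1) ^ 2 / x)) * cpowDiff s (k + 1) (x * u))

lemma norm_exp_neg_pi_I_div (x : ℝ) (k : ℕ) :
    ‖exp (-(Real.pi * I * ((k : ℂ) + 1) ^ 2 / x))‖ = 1 := by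
  have : -(Real.pi * I * ((k : ℂ) + 1) ^ 2 / x)
      = ((-(Real.pi * ((k : ℝ) + 1) ^ 2 / x) : ℝ) : ℂ) * I := by push_cast; ring
  rw [this, norm_exp_ofReal_mul_I]

lemma mul_abs_mul_exp_le {x : ℝ} (hx : 0 < x) (u : ℝ) :
    x * |u| * Real.exp (-(Real.pi * x * u ^ 2)) ≤ √x * Real.exp (-(Real.pi * x / 2) * u ^ 2) := by
  have h1 : -(Real.pi * x * u ^ 2) = -(Real.pi * x / 2) * u ^ 2 + -(Real.pi / 2 * (√x * |u|) ^ 2) := by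
    rw [mul_pow, Real.sq_sqrt hx.le, sq_abs]; ring
  have h2 : √x * |u| * Real.exp (-(Real.pi / 2 * (√x * |u|) ^ 2)) ≤ 1 := by
    set t := √x * |u|
    rw [Real.exp_neg, ← div_eq_mul_inv, div_le_one (Real.exp_pos _)]
    have := Real.add_one_le_exp (Real.pi / 2 * t ^ 2)
    nlinarith [Real.pi_gt_three, sq_nonneg (t - 1), sq_nonneg t]
  have h3 : x * |u| = √x * (√x * |u|) := by rw [← mul_assoc, Real.mul_self_sqrt hx.le]
  rw [h1, Real.exp_add, h3]
  calc _ = √x * Real.exp (-(Real.pi * x / 2) * u ^ 2)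
        * (√x * |u| * Real.exp (-(Real.pi / 2 * (√x * |u|) ^ 2))) := by ring
    _ ≤ √x * Real.exp (-(Real.pi * x / 2) * u ^ 2) * 1 := by gcongr
    _ = _ := mul_one _

lemma norm_corrTerm_le {s x : ℝ} (hs : 0 ≤ s) (hs1 : s ≤ 1) (hx : 0 < x) (k : ℕ) (u : ℝ) :
    ‖corrTerm s x k u‖ ≤ 4 * ((k : ℝ) + 1) ^ (-(s + 1)) * √x
      * Real.exp (-(Real.pi * x / 2) * u ^ 2) := by
  rw [corrTerm, norm_mul, norm_mul, norm_exp_neg_pi_I_div, one_mul, norm_real,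
    Real.norm_of_nonneg (Real.exp_pos _).le]
  have h1 := norm_cpowDiff_le hs hs1 (k := k + 1) (by positivity) (x * u)
  rw [abs_mul, abs_of_pos hx] at h1
  calc _ ≤ Real.exp (-(Real.pi * x * u ^ 2)) * (4 * ((k : ℝ) + 1) ^ (-(s + 1)) * (x * |u|)) := by gcongr
    _ = 4 * ((k : ℝ) + 1) ^ (-(s + 1)) * (x * |u| * Real.exp (-(Real.pi * x * u ^ 2))) := by ring
    _ ≤ 4 * ((k : ℝ) + 1) ^ (-(s + 1)) * (√x * Real.exp (-(Real.pi * x / 2) * u ^ 2)) :=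
        mul_le_mul_of_nonneg_left (mul_abs_mul_exp_le hx u) (by positivity)
    _ = _ := by ring

lemma continuous_cpowDiff {s k : ℝ} (hk : 0 < k) : Continuous (cpowDiff s k) := by
  refine Continuous.sub (Continuous.inv₀ ?_ fun y => ?_) continuous_const
  · exact (continuous_linePt k).cpow continuous_const fun y => linePt_mem_slitPlane hk y
  · simp [cpow_eq_zero_iff, linePt_ne_zero hk y]

lemma integrable_corrTerm {s x : ℝ} (hs : 0 ≤ s) (hs1 : s ≤ 1) (hx : 0 < x) (k : ℕ) :
    Integrable (corrTerm s x k) := by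
  have hpi := Real.pi_pos
  refine integrable_of_gaussian_decay (V := 0) (ε := Real.pi * x / 2) ?_ (by positivity)
    fun u _ => norm_corrTerm_le hs hs1 hx k u
  unfold corrTerm
  refine Continuous.mul (by fun_prop) (continuous_const.mul ?_)
  exact (continuous_cpowDiff (by positivity)).comp (by fun_prop)

lemma integral_norm_corrTerm_le {s x : ℝ} (hs : 0 ≤ s) (hs1 : s ≤ 1) (hx : 0 < x) (k : ℕ) :
    ∫ u, ‖corrTerm s x k u‖ ≤ 8 * ((k : ℝ) + 1) ^ (-(s + 1)) := by
  have hpi := Real.pi_pos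
  have hint : Integrable fun u : ℝ => 4 * ((k : ℝ) + 1) ^ (-(s + 1)) * √x
      * Real.exp (-(Real.pi * x / 2) * u ^ 2) :=
    (integrable_exp_neg_mul_sq (by positivity)).const_mul _
  refine (integral_mono (integrable_corrTerm hs hs1 hx k).norm hint
    (norm_corrTerm_le hs hs1 hx k)).trans ?_
  rw [integral_const_mul, integral_gaussian, mul_assoc, ← Real.sqrt_mul hx.le]
  have h1 : x * (Real.pi / (Real.pi * x / 2)) = 2 := by field_simp
  have h2 : √2 ≤ 2 := Real.sqrt_le_iff.2 ⟨by norm_num, by norm_num⟩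
  rw [h1]
  have : 0 ≤ ((k : ℝ) + 1) ^ (-(s + 1)) := by positivity
  nlinarith

lemma summable_succ_rpow {s : ℝ} (hs : 0 < s) :
    Summable fun k : ℕ => 8 * ((k : ℝ) + 1) ^ (-(s + 1)) := by
  have h := (summable_nat_add_iff 1).2 (Real.summable_nat_rpow.2 (by linarith : -(s + 1) < -1))
  simpa using h.mul_left 8

/-- The integrated correction terms. -/
noncomputable def corrInt (s x : ℝ) (k : ℕ) : ℂ := ∫ u, corrTerm s x k u

lemma norm_corrInt_le {s x : ℝ} (hs : 0 ≤ s) (hs1 : s ≤ 1) (hx : 0 < x) (k : ℕ) :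
    ‖corrInt s x k‖ ≤ 8 * ((k : ℝ) + 1) ^ (-(s + 1)) :=
  (norm_integral_le_integral_norm _).trans (integral_norm_corrTerm_le hs hs1 hx k)

lemma summable_corrInt {s x : ℝ} (hs : 0 < s) (hs1 : s ≤ 1) (hx : 0 < x) :
    Summable (corrInt s x) :=
  Summable.of_norm_bounded (summable_succ_rpow hs) (norm_corrInt_le hs.le hs1 hx)

lemma Ifun_eq {s x : ℝ} (hs : 0 < s) (hs1 : s ≤ 1) (hx : 0 < x) :
    Ifun s x 0 = remInt s x 0 0 + ρ * (x : ℂ) ^ (s : ℂ) * ∑' k, corrInt s x k := by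
  have hsum : Summable fun k : ℕ => ∫ u, ‖corrTerm s x k u‖ :=
    Summable.of_nonneg_of_le (fun k => integral_nonneg fun u => norm_nonneg _)
      (integral_norm_corrTerm_le hs.le hs1 hx) (summable_succ_rpow hs)
  have h := (hasSum_integral_of_summable_integral_norm
    (fun k => integrable_corrTerm hs.le hs1 hx k) hsum).tsum_eq
  unfold corrInt
  rw [h, Ifun]
  congr 1
  · rw [remInt]
    congr 1
    ext u
    have h1 : linePt (((0 : ℕ) : ℝ) + 1 / 2) u = 1 / 2 + ρ * u := by simp [linePt]
    rw [h1, twistedTerm, poleDen, Int.fract_zero, ← div_div, ← div_eq_mul_inv]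
    simp
  · congr 2
    ext u
    simp only [corrTerm, tsum_mul_left, Int.fract_zero, ofReal_zero, sub_zero]
    congr 2
    ext k
    rw [cpowDiff, linePt]
    push_cast
    ring_nf

lemma ofReal_mul_cpow {x : ℝ} (hx : 0 < x) {z : ℂ} (hz : z ≠ 0) (s : ℂ) :
    ((x : ℂ) * z) ^ s = (x : ℂ) ^ s * z ^ s := by
  have hx' : (x : ℂ) ≠ 0 := ofReal_ne_zero.2 hx.ne'
  rw [cpow_def_of_ne_zero (mul_ne_zero hx' hz), cpow_def_of_ne_zero hx', cpow_def_of_ne_zero hz,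
    log_ofReal_mul hx hz, ofReal_log hx.le, add_mul, exp_add]

lemma integral_twistedTerm_succ {s x c : ℝ} (hs : 0 ≤ s) (hs1 : s ≤ 1) (hx : 0 < x) (k : ℕ)
    (hk : (k + 1 : ℕ) ≤ c * x) :
    ∫ u : ℝ, ρ * twistedTerm s x (k + 1) (linePt c u)
      = ρ * (x : ℂ) ^ (s : ℂ) * corrInt s x k + ρ * ((x ^ (s - 1 / 2) : ℝ) : ℂ)
        * (exp (-(Real.pi * I * ((k : ℂ) + 1) ^ 2 / x)) / ((k + 1 : ℕ) : ℂ) ^ (s : ℂ)) := by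
  have hx' : (x : ℂ) ≠ 0 := ofReal_ne_zero.2 hx.ne'
  have hpi := Real.pi_pos
  have hc₁ : 0 < ((k + 1 : ℕ) : ℝ) / x := by positivity
  rw [integral_const_mul, ← integral_twistedTerm_shift hs hx hc₁ (by rwa [div_le_iff₀ hx])]
  have hpt : ∀ u : ℝ, twistedTerm s x (k + 1) (linePt ((k + 1 : ℕ) / x) u)
      = (x : ℂ) ^ (s : ℂ) * corrTerm s x k u + (x : ℂ) ^ (s : ℂ)
        * (exp (-(Real.pi * I * ((k : ℂ) + 1) ^ 2 / x)) / ((k + 1 : ℕ) : ℂ) ^ (s : ℂ))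
        * ((Real.exp (-(Real.pi * x) * u ^ 2) : ℝ) : ℂ) := fun u => by
    have h1 : Real.pi * I * linePt ((k + 1 : ℕ) / x) u ^ 2 * x
        - 2 * Real.pi * I * (k + 1 : ℕ) * linePt ((k + 1 : ℕ) / x) u
        = ((-(Real.pi * x * u ^ 2) : ℝ) : ℂ) + -(Real.pi * I * ((k : ℂ) + 1) ^ 2 / x) := by
      rw [linePt_sq, linePt]
      push_cast
      field_simp
      linear_combination (x : ℂ) ^ 2 * u ^ 2 * I_sq
    have h2 : linePt (k + 1) (x * u) = x * linePt ((k + 1 : ℕ) / x) u := by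
      rw [linePt, linePt]; push_cast; field_simp
    have h3 := ofReal_mul_cpow hx (linePt_ne_zero hc₁ u) (s : ℂ)
    have h4 : (x : ℂ) ^ (s : ℂ) ≠ 0 := by simp [cpow_eq_zero_iff, hx']
    have h5 : (x : ℂ) ^ (s : ℂ) * cpowDiff s (k + 1) (x * u)
        = (linePt ((k + 1 : ℕ) / x) u ^ (s : ℂ))⁻¹
          - (x : ℂ) ^ (s : ℂ) * (((k + 1 : ℕ) : ℂ) ^ (s : ℂ))⁻¹ := by
      rw [cpowDiff, h2, h3, mul_sub, mul_inv, mul_inv_cancel_left₀ h4]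
      push_cast
      rfl
    rw [twistedTerm, h1, exp_add, corrTerm, ← ofReal_exp,
      show -(Real.pi * x) * u ^ 2 = -(Real.pi * x * u ^ 2) by ring]
    linear_combination (-((Real.exp (-(Real.pi * x * u ^ 2)) : ℝ) : ℂ)
      * exp (-(Real.pi * I * ((k : ℂ) + 1) ^ 2 / x))) * h5
  have hg : Integrable fun u : ℝ => ((Real.exp (-(Real.pi * x) * u ^ 2) : ℝ) : ℂ) :=
    (integrable_exp_neg_mul_sq (by positivity)).ofReal
  simp_rw [hpt]
  rw [integral_add ((integrable_corrTerm hs hs1 hx k).const_mul _) (hg.const_mul _),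
    integral_const_mul, integral_const_mul, integral_complex_ofReal, integral_gaussian, ← corrInt,
    show Real.pi / (Real.pi * x) = x⁻¹ by field_simp]
  have h6 : ((x ^ (s - 1 / 2) : ℝ) : ℂ) = (x : ℂ) ^ (s : ℂ) * ((√x⁻¹ : ℝ) : ℂ) := by
    rw [← ofReal_cpow hx.le, ← ofReal_mul, Real.rpow_sub hx, Real.sqrt_inv, Real.sqrt_eq_rpow,
      div_eq_mul_inv]
  rw [h6]
  ring

lemma remInt_eq_sum {s x : ℝ} (hs : 0 ≤ s) (hs1 : s ≤ 1) (hx : 0 < x) (N K : ℕ)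
    (hK : K ≤ (N + 1 / 2) * x) :
    remInt s x K N = remInt s x 0 N + ρ * (x : ℂ) ^ (s : ℂ) * ∑ k ∈ Finset.range K, corrInt s x k
      + ρ * ((x ^ (s - 1 / 2) : ℝ) : ℂ) * Fpart s K (-1 / x) 0 := by
  induction K with
  | zero => simp [Fpart]
  | succ K ih =>
    have hK' : (K : ℝ) ≤ (N + 1 / 2) * x := by push_cast at hK; linarith
    rw [remInt_succ_left hs hx, ih hK', integral_twistedTerm_succ hs hs1 hx K hK, Fpart, Fpart,
      Finset.sum_Icc_succ_top (by omega), Finset.sum_range_succ]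
    have : Real.pi * I * ((K + 1 : ℕ) : ℂ) ^ 2 * ((-1 / x : ℝ) : ℂ)
        + 2 * Real.pi * I * ((K + 1 : ℕ) : ℂ) * ((0 : ℝ) : ℂ)
        = -(Real.pi * I * ((K : ℂ) + 1) ^ 2 / x) := by push_cast; ring
    rw [this]
    ring

/-- Defect in the approximate functional equation. -/
noncomputable def defect (s x : ℝ) (N : ℕ) : ℂ :=
  Fpart s N x 0 - Ifun s x 0
    - ρ * ((x ^ (s - 1 / 2) : ℝ) : ℂ) * Fpart s ⌊(N + 1 / 2) * x⌋₊ (-1 / x) 0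

lemma defect_eq {s x : ℝ} (hs : 0 < s) (hs1 : s ≤ 1) (hx : 0 < x) (N : ℕ) :
    defect s x N = -(ρ * (x : ℂ) ^ (s : ℂ) * ∑' k, corrInt s x (k + ⌊(N + 1 / 2) * x⌋₊))
      - remInt s x ⌊(N + 1 / 2) * x⌋₊ N := by
  have h1 := remInt_eq_sum hs.le hs1 hx N ⌊(N + 1 / 2) * x⌋₊ (Nat.floor_le (by positivity))
  have h2 := (summable_corrInt hs hs1 hx).sum_add_tsum_nat_add ⌊(N + 1 / 2) * x⌋₊
  rw [defect, Ifun_eq hs hs1 hx, Fpart_eq_remInt_sub hs.le hx, h1, ← h2]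
  ring

/-- Uniform constant in the approximate functional equation. -/
noncomputable def defectConst (s : ℝ) : ℝ := (∑' k : ℕ, 8 * ((k : ℝ) + 1) ^ (-(s + 1))) + 8

lemma norm_cpow_le_one {s x : ℝ} (hs : 0 ≤ s) (hx : 0 < x) (hx1 : x ≤ 1) : ‖(x : ℂ) ^ (s : ℂ)‖ ≤ 1 := by
  rw [norm_cpow_eq_rpow_re_of_pos hx, ofReal_re]
  exact Real.rpow_le_one hx.le hx1 hs

lemma norm_defect_le {s x : ℝ} (hs : 0 < s) (hs1 : s ≤ 1) (hx : 0 < x) (hx1 : x ≤ 1) (N : ℕ) :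
    ‖defect s x N‖ ≤ defectConst s * (√x)⁻¹ := by
  rw [defect_eq hs hs1 hx]
  set K := ⌊(N + 1 / 2) * x⌋₊ with hK
  have hsum := summable_succ_rpow hs
  have h1 : ‖∑' k, corrInt s x (k + K)‖ ≤ ∑' k : ℕ, 8 * ((k : ℝ) + 1) ^ (-(s + 1)) := by
    refine (tsum_of_norm_bounded ((summable_nat_add_iff K).2 hsum).hasSum
      fun k => norm_corrInt_le hs.le hs1 hx (k + K)).trans ?_
    rw [← hsum.sum_add_tsum_nat_add K]
    exact le_add_of_nonneg_left (Finset.sum_nonneg fun k _ => by positivity)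
  have h2 := norm_remInt_le hs.le hs1 hx N
  have h3 : (((N : ℝ) + 1 / 2) ^ s)⁻¹ ≤ 2 := by
    rw [inv_le_comm₀ (by positivity) (by norm_num)]
    calc (2 : ℝ)⁻¹ = (1 / 2) ^ (1 : ℝ) := by norm_num
      _ ≤ (1 / 2) ^ s := Real.rpow_le_rpow_of_exponent_ge (by norm_num) (by norm_num) hs1
      _ ≤ _ := by gcongr; linarith [(N.cast_nonneg : (0 : ℝ) ≤ N)]
  have h4 : 1 ≤ (√x)⁻¹ := (one_le_inv₀ (by positivity)).2 (Real.sqrt_le_one.2 hx1)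
  have h5 := norm_cpow_le_one hs.le hx hx1
  have h6 : 0 ≤ ∑' k : ℕ, 8 * ((k : ℝ) + 1) ^ (-(s + 1)) := tsum_nonneg fun k => by positivity
  refine (norm_sub_le _ _).trans ?_
  rw [norm_neg, norm_mul, norm_mul, norm_rho, one_mul, defectConst, add_mul]
  refine add_le_add ?_ (h2.trans ?_)
  · calc _ ≤ 1 * ∑' k : ℕ, 8 * ((k : ℝ) + 1) ^ (-(s + 1)) := by gcongr
      _ ≤ _ := by rw [one_mul]; exact le_mul_of_one_le_right h6 h4
  · gcongr; linarith

lemma tendsto_floor_half_mul {x : ℝ} (hx : 0 < x) :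
    Tendsto (fun N : ℕ => ⌊((N : ℝ) + 1 / 2) * x⌋₊) atTop atTop :=
  tendsto_nat_floor_atTop.comp (Tendsto.atTop_mul_const hx
    (tendsto_atTop_add_const_right _ _ tendsto_natCast_atTop_atTop))

lemma tendsto_defect {s x : ℝ} (hs : 0 < s) (hs1 : s ≤ 1) (hx : 0 < x) :
    Tendsto (defect s x) atTop (𝓝 0) := by
  have h1 := ((tendsto_sum_nat_add (corrInt s x)).comp (tendsto_floor_half_mul hx)).const_mul
    (ρ * (x : ℂ) ^ (s : ℂ))
  have h2 : Tendsto (fun N : ℕ => remInt s x ⌊(N + 1 / 2) * x⌋₊ N) atTop (𝓝 0) := by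
    refine squeeze_zero_norm (fun N => norm_remInt_le hs.le hs1 hx N) ?_
    have : Tendsto (fun N : ℕ => ((N : ℝ) + 1 / 2) ^ s) atTop atTop :=
      (tendsto_rpow_atTop hs).comp
        (tendsto_atTop_add_const_right _ _ tendsto_natCast_atTop_atTop)
    simpa using (this.inv_tendsto_atTop.const_mul 4).mul_const (√x)⁻¹
  have h3 := h1.neg.sub h2
  simp only [mul_zero, neg_zero, sub_zero] at h3
  refine h3.congr fun N => ?_
  rw [defect_eq hs hs1 hx]
  rfl

lemma Fpart_neg (s x : ℝ) (n : ℕ) : Fpart s n (-x) 0 = (starRingEnd ℂ) (Fpart s n x 0) := by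
  simp only [Fpart, map_sum, map_div₀, ← exp_conj]
  refine Finset.sum_congr rfl fun k _ => ?_
  rw [← ofReal_natCast k, ← ofReal_cpow k.cast_nonneg]
  simp

lemma Fpart_sub_two_mul_intCast (s x : ℝ) (n : ℕ) (m : ℤ) :
    Fpart s n (x - 2 * m) 0 = Fpart s n x 0 := by
  simp only [Fpart]
  refine Finset.sum_congr rfl fun k _ => ?_
  congr 1
  refine exp_eq_exp_iff_exists_int.2 ⟨-(k ^ 2 * m), ?_⟩
  push_cast
  ring

lemma Fpart_Tmap (s x : ℝ) (n : ℕ) : Fpart s n (Tmap x) 0 = Fpart s n (-1 / x) 0 :=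
  Fpart_sub_two_mul_intCast s _ n _

lemma Fpart_zero (s x t : ℝ) : Fpart s 0 x t = 0 := by simp [Fpart]

lemma norm_Fpart_le {s : ℝ} (hs : 0 ≤ s) (n : ℕ) (x : ℝ) : ‖Fpart s n x 0‖ ≤ n := by
  refine (norm_sum_le_of_le _ (f := _) (n := fun _ => (1 : ℝ)) fun k hk => ?_).trans (by simp)
  have hk1 : (1 : ℝ) ≤ k := by exact_mod_cast (Finset.mem_Icc.1 hk).1
  have h : Real.pi * I * (k : ℂ) ^ 2 * (x : ℂ) + 2 * Real.pi * I * (k : ℂ) * ((0 : ℝ) : ℂ)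
      = ((Real.pi * k ^ 2 * x : ℝ) : ℂ) * I := by push_cast; ring
  rw [norm_div, h, norm_exp_ofReal_mul_I, ← ofReal_natCast k, ← ofReal_cpow k.cast_nonneg,
    norm_real, Real.norm_of_nonneg (by positivity)]
  exact div_le_one_of_le₀ (Real.one_le_rpow hk1 hs) (by positivity)

/-- The error in the finite functional equation relating `F_s` at `x` and at `Tmap x`. -/
noncomputable def signedDefect (s x : ℝ) (N : ℕ) : ℂ :=
  if 0 < x then defect s x N else (starRingEnd ℂ) (defect s (-x) N)

lemma Fpart_eq_Omega0_add {s x : ℝ} (hx : x ≠ 0) (N : ℕ) :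
    Fpart s N x 0 = Omega0 s x + signedDefect s x N
      + exp (Real.pi * I / 4 * (Real.sign x : ℝ)) * ((|x| ^ (s - 1 / 2) : ℝ) : ℂ)
        * Fpart s ⌊((N : ℝ) + 1 / 2) * |x|⌋₊ (Tmap x) 0 := by
  rw [Fpart_Tmap, Omega0, Omega, signedDefect]
  rcases lt_or_gt_of_ne hx with h | h
  · have h' : ¬ 0 < x := h.not_gt
    rw [if_neg h', if_neg h', abs_of_neg h, Real.sign_of_neg h, defect]
    have e1 : Fpart s N x 0 = (starRingEnd ℂ) (Fpart s N (-x) 0) := by rw [← Fpart_neg, neg_neg]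
    have e2 : Fpart s ⌊((N : ℝ) + 1 / 2) * -x⌋₊ (-1 / x) 0
        = (starRingEnd ℂ) (Fpart s ⌊((N : ℝ) + 1 / 2) * -x⌋₊ (-1 / -x) 0) := by
      rw [← Fpart_neg]; congr 1; field_simp
    have e3 : exp (Real.pi * I / 4 * ((-1 : ℝ) : ℂ)) = (starRingEnd ℂ) ρ := by
      rw [ρ, ← exp_conj]; congr 1; simp [neg_div, map_ofNat (starRingEnd ℂ) 4]
    rw [e1, e2, e3, neg_zero]
    simp only [map_sub, map_mul, conj_ofReal]
    ring
  · rw [if_pos h, if_pos h, abs_of_pos h, Real.sign_of_pos h, defect]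
    have e3 : exp (Real.pi * I / 4 * ((1 : ℝ) : ℂ)) = ρ := by simp [ρ]
    rw [e3]
    ring

lemma norm_signedDefect_le {s x : ℝ} (hs : 0 < s) (hs1 : s ≤ 1) (hx : x ≠ 0) (hx1 : |x| ≤ 1)
    (N : ℕ) : ‖signedDefect s x N‖ ≤ defectConst s * (√|x|)⁻¹ := by
  rw [signedDefect]
  rcases lt_or_gt_of_ne hx with h | h
  · rw [abs_of_neg h] at hx1 ⊢
    rw [if_neg h.not_gt, RCLike.norm_conj]
    exact norm_defect_le hs hs1 (by linarith) hx1 N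
  · rw [abs_of_pos h] at hx1 ⊢
    rw [if_pos h]
    exact norm_defect_le hs hs1 h hx1 N

lemma tendsto_signedDefect {s x : ℝ} (hs : 0 < s) (hs1 : s ≤ 1) (hx : x ≠ 0) :
    Tendsto (signedDefect s x) atTop (𝓝 0) := by
  rcases lt_or_gt_of_ne hx with h | h
  · have := (continuous_conj.tendsto _).comp (tendsto_defect hs hs1 (x := -x) (by linarith))
    rw [map_zero] at this
    refine this.congr fun N => ?_
    rw [signedDefect, if_neg h.not_gt]; rfl
  · refine (tendsto_defect hs hs1 h).congr fun N => ?_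
    rw [signedDefect, if_pos h]

lemma norm_Omega0_le {s x : ℝ} (hs : 0 < s) (hs1 : s ≤ 1) (hx : x ≠ 0) (hx1 : |x| ≤ 1) :
    ‖Omega0 s x‖ ≤ defectConst s * (√|x|)⁻¹ := by
  have h := Fpart_eq_Omega0_add (s := s) hx 0
  have hK : ⌊(((0 : ℕ) : ℝ) + 1 / 2) * |x|⌋₊ = 0 := by
    rw [Nat.floor_eq_zero]; push_cast; linarith
  rw [hK, Fpart_zero, Fpart_zero, mul_zero, add_zero] at h
  rw [eq_neg_of_add_eq_zero_left h.symm, norm_neg]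
  exact norm_signedDefect_le hs hs1 hx hx1 0

lemma abs_Tmap_le_one (x : ℝ) : |Tmap x| ≤ 1 := by
  have h1 := Int.le_ceil ((-1 / x - 1) / 2)
  have h2 := Int.ceil_lt_add_one ((-1 / x - 1) / 2)
  rw [Tmap, abs_le]
  constructor <;> linarith

lemma irrational_Tmap {x : ℝ} (hx : Irrational x) : Irrational (Tmap x) := by
  have h : Irrational (-1 / x) := by
    rw [neg_div, one_div]; exact hx.inv.neg
  simpa [Tmap] using h.sub_intCast (2 * ⌈((-1 / x) - 1) / 2⌉)

lemma irrational_Tmap_iterate {x : ℝ} (hx : Irrational x) (j : ℕ) : Irrational (Tmap^[j] x) := by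
  induction j with
  | zero => exact hx
  | succ j ih => rw [Function.iterate_succ_apply']; exact irrational_Tmap ih

lemma abs_Tmap_iterate_lt_one {x : ℝ} (hx : Irrational x) (hx1 : |x| ≤ 1) (j : ℕ) :
    |Tmap^[j] x| < 1 := by
  have h : |Tmap^[j] x| ≤ 1 := by
    cases j with
    | zero => exact hx1
    | succ j => rw [Function.iterate_succ_apply']; exact abs_Tmap_le_one _
  refine lt_of_le_of_ne h fun h1 => ?_
  rcases (abs_eq zero_le_one).1 h1 with h2 | h2
  · exact (irrational_Tmap_iterate hx j).ne_one h2
  · exact (irrational_Tmap_iterate hx j).ne_int (-1) (by simpa using h2)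

/-- The product of the absolute values of the first `j` points of the orbit of `x`. -/
noncomputable def orbitProd (x : ℝ) (j : ℕ) : ℝ := ∏ ℓ ∈ Finset.range j, |Tmap^[ℓ] x|

lemma orbitProd_zero (x : ℝ) : orbitProd x 0 = 1 := by simp [orbitProd]

lemma orbitProd_succ (x : ℝ) (j : ℕ) : orbitProd x (j + 1) = orbitProd x j * |Tmap^[j] x| :=
  Finset.prod_range_succ _ _

lemma orbitProd_pos {x : ℝ} (hx : Irrational x) (j : ℕ) : 0 < orbitProd x j :=
  Finset.prod_pos fun ℓ _ => abs_pos.2 (irrational_Tmap_iterate hx ℓ).ne_zero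

lemma orbitProd_le_one {x : ℝ} (hx : Irrational x) (hx1 : |x| ≤ 1) (j : ℕ) : orbitProd x j ≤ 1 :=
  Finset.prod_le_one (fun _ _ => abs_nonneg _) fun ℓ _ => (abs_Tmap_iterate_lt_one hx hx1 ℓ).le

/-- The coefficient of `Ω_s(T^j(x))` in the expansion of `F_s(x)`. -/
noncomputable def orbitCoef (s x : ℝ) (j : ℕ) : ℂ :=
  exp (Real.pi * I / 4 * ((∑ ℓ ∈ Finset.range j, Real.sign (Tmap^[ℓ] x) : ℝ) : ℂ))
    * ((orbitProd x j ^ (s - 1 / 2) : ℝ) : ℂ)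

lemma orbitCoef_zero (s x : ℝ) : orbitCoef s x 0 = 1 := by simp [orbitCoef, orbitProd_zero]

lemma orbitCoef_succ {x : ℝ} (s : ℝ) (hx : Irrational x) (j : ℕ) :
    orbitCoef s x (j + 1) = orbitCoef s x j
      * (exp (Real.pi * I / 4 * (Real.sign (Tmap^[j] x) : ℝ))
        * ((|Tmap^[j] x| ^ (s - 1 / 2) : ℝ) : ℂ)) := by
  rw [orbitCoef, orbitCoef, orbitProd_succ, Finset.sum_range_succ,
    Real.mul_rpow (orbitProd_pos hx j).le (abs_nonneg _), ofReal_add, mul_add, exp_add, ofReal_mul]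
  ring

lemma norm_orbitCoef {x : ℝ} (s : ℝ) (hx : Irrational x) (j : ℕ) :
    ‖orbitCoef s x j‖ = orbitProd x j ^ (s - 1 / 2) := by
  have h (a : ℝ) : Real.pi * I / 4 * (a : ℂ) = ((Real.pi / 4 * a : ℝ) : ℂ) * I := by
    push_cast; ring
  rw [orbitCoef, h, norm_mul, norm_exp_ofReal_mul_I, one_mul, norm_real,
    Real.norm_of_nonneg (Real.rpow_nonneg (orbitProd_pos hx j).le _)]

/-- The lengths of the partial sums obtained by iterating the finite functional equation. -/
noncomputable def orbitLen (x : ℝ) (N : ℕ) : ℕ → ℕ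
  | 0 => N
  | j + 1 => ⌊((orbitLen x N j : ℝ) + 1 / 2) * |Tmap^[j] x|⌋₊

lemma orbitLen_le {x : ℝ} (hx : Irrational x) (hx1 : |x| ≤ 1) (N j : ℕ) : orbitLen x N j ≤ N := by
  induction j with
  | zero => exact le_rfl
  | succ j ih =>
    refine le_trans ?_ ih
    rw [orbitLen, ← Nat.lt_succ_iff, Nat.floor_lt (by positivity)]
    have := (abs_Tmap_iterate_lt_one hx hx1 j).le
    have h : ((orbitLen x N j : ℝ) + 1 / 2) * |Tmap^[j] x| ≤ (orbitLen x N j : ℝ) + 1 / 2 :=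
      mul_le_of_le_one_right (by positivity) this
    push_cast
    linarith

lemma tendsto_orbitLen {x : ℝ} (hx : Irrational x) (j : ℕ) :
    Tendsto (fun N => orbitLen x N j) atTop atTop := by
  induction j with
  | zero => exact tendsto_id
  | succ j ih =>
    exact (tendsto_floor_half_mul (abs_pos.2 (irrational_Tmap_iterate hx j).ne_zero)).comp ih

lemma Fpart_eq_sum_orbit {s x : ℝ} (hx : Irrational x) (N J : ℕ) :
    Fpart s N x 0 = ∑ j ∈ Finset.range J, orbitCoef s x j
        * (Omega0 s (Tmap^[j] x) + signedDefect s (Tmap^[j] x) (orbitLen x N j))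
      + orbitCoef s x J * Fpart s (orbitLen x N J) (Tmap^[J] x) 0 := by
  induction J with
  | zero => simp [orbitCoef_zero, orbitLen]
  | succ J ih =>
    rw [ih, Finset.sum_range_succ, orbitCoef_succ s hx, Function.iterate_succ_apply',
      Fpart_eq_Omega0_add (irrational_Tmap_iterate hx J).ne_zero (orbitLen x N J), orbitLen]
    ring

lemma tendsto_Fpart_of_summable {s x : ℝ} (hs : 1 / 2 < s) (hs1 : s ≤ 1) (hx : Irrational x)
    (hx1 : |x| ≤ 1)
    (hS : Summable fun j => orbitProd x j ^ (s - 1 / 2) * (√|Tmap^[j] x|)⁻¹) :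
    ∃ L : ℂ, Tendsto (fun n => Fpart s n x 0) atTop (𝓝 L) ∧
      HasSum (fun j => orbitCoef s x j * Omega0 s (Tmap^[j] x)) L := by
  have hs0 : 0 < s := by linarith
  have hne j := (irrational_Tmap_iterate hx j).ne_zero
  have hle j := (abs_Tmap_iterate_lt_one hx hx1 j).le
  have hb (j : ℕ) : ‖orbitCoef s x j * Omega0 s (Tmap^[j] x)‖
      ≤ defectConst s * (orbitProd x j ^ (s - 1 / 2) * (√|Tmap^[j] x|)⁻¹) := by
    rw [norm_mul, norm_orbitCoef s hx, mul_left_comm]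
    exact mul_le_mul_of_nonneg_left (norm_Omega0_le hs0 hs1 (hne j) (hle j))
      (Real.rpow_nonneg (orbitProd_pos hx j).le _)
  have hd (N j : ℕ) : ‖orbitCoef s x j * signedDefect s (Tmap^[j] x) (orbitLen x N j)‖
      ≤ defectConst s * (orbitProd x j ^ (s - 1 / 2) * (√|Tmap^[j] x|)⁻¹) := by
    rw [norm_mul, norm_orbitCoef s hx, mul_left_comm]
    exact mul_le_mul_of_nonneg_left (norm_signedDefect_le hs0 hs1 (hne j) (hle j) _)
      (Real.rpow_nonneg (orbitProd_pos hx j).le _)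
  have hS' := hS.mul_left (defectConst s)
  have hO : Summable fun j => orbitCoef s x j * Omega0 s (Tmap^[j] x) := .of_norm_bounded hS' hb
  have hD (N : ℕ) : Summable fun j =>
      orbitCoef s x j * signedDefect s (Tmap^[j] x) (orbitLen x N j) := .of_norm_bounded hS' (hd N)
  have hcoef : Tendsto (fun J => orbitProd x J ^ (s - 1 / 2)) atTop (𝓝 0) := by
    refine squeeze_zero (fun J => Real.rpow_nonneg (orbitProd_pos hx J).le _) (fun J => ?_)
      hS.tendsto_atTop_zero
    refine le_mul_of_one_le_right (Real.rpow_nonneg (orbitProd_pos hx J).le _) ?_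
    exact (one_le_inv₀ (Real.sqrt_pos.2 (abs_pos.2 (hne J)))).2 (Real.sqrt_le_one.2 (hle J))
  have hF (N : ℕ) : Fpart s N x 0 = ∑' j, orbitCoef s x j * Omega0 s (Tmap^[j] x)
      + ∑' j, orbitCoef s x j * signedDefect s (Tmap^[j] x) (orbitLen x N j) := by
    have h1 : Tendsto (fun J => orbitCoef s x J * Fpart s (orbitLen x N J) (Tmap^[J] x) 0) atTop
        (𝓝 0) := by
      refine squeeze_zero_norm (fun J => ?_) (by simpa only [zero_mul] using hcoef.mul_const (N : ℝ))
      rw [norm_mul, norm_orbitCoef s hx]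
      exact mul_le_mul_of_nonneg_left ((norm_Fpart_le hs0.le _ _).trans
        (Nat.cast_le.2 (orbitLen_le hx hx1 N J))) (Real.rpow_nonneg (orbitProd_pos hx J).le _)
    have h2 := (hO.add (hD N)).hasSum.tendsto_sum_nat.add h1
    rw [add_zero, hO.tsum_add (hD N)] at h2
    refine tendsto_nhds_unique (tendsto_const_nhds (f := atTop (α := ℕ))) (h2.congr fun J => ?_)
    rw [Fpart_eq_sum_orbit hx N J]
    simp only [mul_add]
  refine ⟨_, ?_, hO.hasSum⟩
  have h0 : Tendsto (fun N => ∑' j, orbitCoef s x j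
      * signedDefect s (Tmap^[j] x) (orbitLen x N j)) atTop (𝓝 (∑' _ : ℕ, (0 : ℂ))) := by
    refine tendsto_tsum_of_dominated_convergence hS' (fun j => ?_) (.of_forall fun N j => hd N j)
    simpa using ((tendsto_signedDefect hs0 hs1 (hne j)).comp
      (tendsto_orbitLen hx j)).const_mul (orbitCoef s x j)
  rw [tsum_zero] at h0
  simpa [hF] using h0.const_add (∑' j, orbitCoef s x j * Omega0 s (Tmap^[j] x))

/-- The signed products along the orbit of `x` are integral linear forms in `x`, with unimodular
consecutive coefficients. -/
lemma exists_orbit_linear_form {x : ℝ} (hx : Irrational x) (hx1 : |x| ≤ 1) (j : ℕ) :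
    ∃ (u : ℝ) (A B A' B' : ℤ), |u| = orbitProd x j ∧ u = A * x - B ∧
      u * Tmap^[j] x = A' * x - B' ∧ u * (A' - A * Tmap^[j] x) = 1 ∧ |A| < |A'| := by
  induction j with
  | zero => exact ⟨1, 0, -1, 1, 0, by simp [orbitProd_zero]⟩
  | succ j ih =>
    obtain ⟨u, A, B, A', B', hu, huA, huA', hW, hlt⟩ := ih
    have hX := abs_Tmap_iterate_lt_one hx hx1 j
    have hX0 := (irrational_Tmap_iterate hx j).ne_zero
    rw [Function.iterate_succ_apply', orbitProd_succ, ← hu]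
    set X := Tmap^[j] x
    have hm : ⌈((-1 / X) - 1) / 2⌉ ≠ 0 := by
      intro h
      have h1 := abs_Tmap_le_one X
      rw [Tmap, h, Int.cast_zero, mul_zero, sub_zero, abs_div, abs_neg, abs_one,
        div_le_one (abs_pos.2 hX0)] at h1
      linarith
    set m := ⌈((-1 / X) - 1) / 2⌉ with hmdef
    have hT : X * Tmap X = -1 - 2 * m * X := by
      rw [Tmap, ← hmdef]; field_simp
    refine ⟨u * X, A', B', -A - 2 * m * A', -B - 2 * m * B', abs_mul _ _, huA', ?_, ?_, ?_⟩
    · rw [mul_assoc, hT]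
      push_cast
      linear_combination -huA - 2 * (m : ℝ) * huA'
    · push_cast
      linear_combination hW - (A' : ℝ) * u * hT
    · have h2 : |A'| ≤ |m| * |A'| := le_mul_of_one_le_left (abs_nonneg _) (Int.one_le_abs hm)
      have h3 := abs_sub_abs_le_abs_sub (2 * m * A') (-A)
      rw [abs_mul, abs_mul, abs_neg, Nat.abs_ofNat, abs_sub_comm] at h3
      linarith

lemma orbitProd_lower_bounds {x κ c : ℝ} (hx : Irrational x) (hx1 : |x| ≤ 1) (hκ : 0 ≤ κ)
    (hD : ∀ A B : ℤ, A ≠ 0 → c ≤ |(A : ℝ)| ^ κ * |A * x - B|) (j : ℕ) :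
    c ≤ (2 / orbitProd x j) ^ κ * (orbitProd x j * (1 - |Tmap^[j] x|)) ∧
      (|Tmap^[j] x| ≤ 1 / 2 →
        c ≤ (2 / orbitProd x j) ^ κ * (orbitProd x j * |Tmap^[j] x|)) := by
  obtain ⟨u, A, B, A', B', hu, huA, huA', hW, hlt⟩ := exists_orbit_linear_form hx hx1 j
  have hX := abs_Tmap_iterate_lt_one hx hx1 j
  have hp := orbitProd_pos hx j
  set X := Tmap^[j] x
  set p := orbitProd x j
  have hW' : |(A' : ℝ) - A * X| = 1 / p := by
    rw [eq_div_iff hp.ne', ← hu, ← abs_mul, mul_comm, hW, abs_one]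
  have hltR : |(A : ℝ)| < |(A' : ℝ)| := by exact_mod_cast hlt
  have h1 : |(A' : ℝ)| - |(A : ℝ)| * |X| ≤ 1 / p := by
    rw [← hW', ← abs_mul]; exact abs_sub_abs_le_abs_sub _ _
  constructor
  · obtain ⟨σ, hσ, hσX⟩ : ∃ σ : ℤ, |σ| = 1 ∧ (σ : ℝ) * X = |X| := by
      rcases le_total 0 X with h | h
      · exact ⟨1, by simp, by simp [abs_of_nonneg h]⟩
      · exact ⟨-1, by simp, by simp [abs_of_nonpos h]⟩
    have hσR : |(σ : ℝ)| = 1 := by exact_mod_cast hσ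
    have hσ2 : (σ : ℝ) * σ = 1 := by rw [← abs_mul_abs_self, hσR, one_mul]
    have hne : A' - σ * A ≠ 0 := by
      intro h
      rw [sub_eq_zero.1 h, abs_mul, hσ, one_mul] at hlt
      exact lt_irrefl _ hlt
    have h2 : |((A' - σ * A : ℤ) : ℝ)| ≤ 2 / p := by
      have e : ((A' - σ * A : ℤ) : ℝ) = (A' - A * X) - σ * A * (1 - |X|) := by
        rw [← hσX]; push_cast; linear_combination -((A : ℝ) * X) * hσ2
      have h3 := abs_sub (A' - A * X : ℝ) (σ * A * (1 - |X|))
      rw [e]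
      refine h3.trans ?_
      rw [abs_mul, abs_mul, hσR, one_mul, hW', abs_of_pos (sub_pos.2 hX)]
      have : 2 / p = 1 / p + 1 / p := by ring
      nlinarith
    have h4 : ((A' - σ * A : ℤ) : ℝ) * x - ((B' - σ * B : ℤ) : ℝ) = -σ * (u * (1 - |X|)) := by
      rw [← hσX]
      push_cast
      linear_combination (σ : ℝ) * huA - huA' - (u * X) * hσ2
    have h5 := hD (A' - σ * A) (B' - σ * B) hne
    rw [h4, abs_mul, abs_neg, hσR, one_mul, abs_mul, hu, abs_of_pos (sub_pos.2 hX)] at h5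
    refine h5.trans ?_
    have := sub_pos.2 hX
    gcongr
  · intro hX2
    have hne : A' ≠ 0 := by
      rintro rfl
      simp at hlt
      exact absurd hlt (abs_nonneg _).not_gt
    have h5 := hD A' B' hne
    rw [← huA', abs_mul, hu] at h5
    refine h5.trans ?_
    gcongr
    have : 2 / p = 1 / p + 1 / p := by ring
    nlinarith [abs_nonneg (A : ℝ)]

lemma rpow_mul_inv_sqrt_le_of_half_le {p X s κ η c : ℝ} (hp : 0 < p) (hX : 1 / 2 ≤ X) (hX1 : X < 1)
    (hη : 0 < η) (hη1 : η ≤ 1) (hηs : η = s + 1 / 2 - κ) (hc : 0 < c)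
    (h : c ≤ (2 / p) ^ κ * (p * (1 - X))) :
    p ^ (s - 1 / 2) * (√X)⁻¹ ≤ 2 * (2 ^ κ / c) / η * (p ^ η - (p * X) ^ η) := by
  have hX0 : 0 < X := by linarith
  have h1 : (√X)⁻¹ ≤ 2 := by
    rw [inv_le_comm₀ (Real.sqrt_pos.2 hX0) two_pos]
    exact Real.le_sqrt_of_sq_le (by linarith)
  have h2 : X ^ η ≤ 1 - η * (1 - X) := by
    have := rpow_one_add_le_one_add_mul_self (s := X - 1) (by linarith) hη.le hη1
    rw [add_sub_cancel] at this
    linarith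
  have h3 : p ^ (κ - 1) ≤ 2 ^ κ / c * (1 - X) := by
    rw [Real.div_rpow two_pos.le hp.le, div_mul_eq_mul_div, le_div_iff₀ (by positivity)] at h
    rw [Real.rpow_sub_one hp.ne', div_mul_eq_mul_div, div_le_div_iff₀ hp hc]
    linarith
  have h4 : p ^ (s - 1 / 2) = p ^ η * p ^ (κ - 1) := by
    rw [← Real.rpow_add hp, hηs]; congr 1; ring
  rw [Real.mul_rpow hp.le hX0.le, h4]
  calc p ^ η * p ^ (κ - 1) * (√X)⁻¹ ≤ p ^ η * (2 ^ κ / c * (1 - X)) * 2 := by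
        have : 0 ≤ 1 - X := by linarith
        gcongr
    _ = 2 * (2 ^ κ / c) / η * (p ^ η * (η * (1 - X))) := by field_simp
    _ ≤ 2 * (2 ^ κ / c) / η * (p ^ η * (1 - X ^ η)) := by gcongr; linarith
    _ = _ := by ring

lemma rpow_mul_inv_sqrt_le_of_le_half {p X s κ η c : ℝ} (hp : 0 < p) (hp1 : p ≤ 1) (hX0 : 0 < X)
    (hX : X ≤ 1 / 2) (hκ : 1 ≤ κ)
    (hη : 0 < η) (hηs : η = s + 1 / 2 - κ) (hc : 0 < c) (h : c ≤ (2 / p) ^ κ * (p * X)) :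
    p ^ (s - 1 / 2) * (√X)⁻¹ ≤ √(2 ^ κ / c) / (1 - (1 / 2) ^ η) * (p ^ η - (p * X) ^ η) := by
  have h0 : (0 : ℝ) < 1 - (1 / 2) ^ η := by
    have := Real.rpow_lt_one (x := 1 / 2) (by norm_num) (by norm_num) hη
    linarith
  have h3 : p ^ (κ - 1) ≤ 2 ^ κ / c * X := by
    rw [Real.div_rpow two_pos.le hp.le, div_mul_eq_mul_div, le_div_iff₀ (by positivity)] at h
    rw [Real.rpow_sub_one hp.ne', div_mul_eq_mul_div, div_le_div_iff₀ hp hc]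
    linarith
  have h4 : p ^ ((κ - 1) / 2) * (√X)⁻¹ ≤ √(2 ^ κ / c) := by
    rw [← div_eq_mul_inv, div_le_iff₀ (Real.sqrt_pos.2 hX0), ← Real.sqrt_mul (by positivity)]
    refine Real.le_sqrt_of_sq_le ?_
    rw [← Real.rpow_natCast, ← Real.rpow_mul hp.le]
    simpa using h3
  have h5 : p ^ (s - 1 / 2) ≤ p ^ η * p ^ ((κ - 1) / 2) := by
    rw [← Real.rpow_add hp]
    exact Real.rpow_le_rpow_of_exponent_ge hp hp1 (by linarith)
  have h6 : X ^ η ≤ (1 / 2) ^ η := Real.rpow_le_rpow hX0.le hX hη.le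
  rw [Real.mul_rpow hp.le hX0.le]
  calc p ^ (s - 1 / 2) * (√X)⁻¹ ≤ p ^ η * p ^ ((κ - 1) / 2) * (√X)⁻¹ := by gcongr
    _ = p ^ η * (p ^ ((κ - 1) / 2) * (√X)⁻¹) := by ring
    _ ≤ p ^ η * √(2 ^ κ / c) := by gcongr
    _ = √(2 ^ κ / c) / (1 - (1 / 2) ^ η) * (p ^ η * (1 - (1 / 2) ^ η)) := by field_simp
    _ ≤ √(2 ^ κ / c) / (1 - (1 / 2) ^ η) * (p ^ η * (1 - X ^ η)) := by gcongr
    _ = _ := by ring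

lemma summable_of_le_mul_sub {f g : ℕ → ℝ} {C : ℝ} (hC : 0 ≤ C) (hf : ∀ j, 0 ≤ f j)
    (hg : ∀ j, 0 ≤ g j) (h : ∀ j, f j ≤ C * (g j - g (j + 1))) : Summable f := by
  refine summable_of_sum_range_le (c := C * g 0) hf fun n => ?_
  refine (Finset.sum_le_sum fun j _ => h j).trans ?_
  rw [← Finset.mul_sum, Finset.sum_range_sub']
  exact mul_le_mul_of_nonneg_left (by linarith [hg n]) hC

lemma summable_orbit {x s κ c : ℝ} (hx : Irrational x) (hx1 : |x| ≤ 1) (hs1 : s ≤ 1)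
    (hκ : 1 ≤ κ) (hκs : κ < s + 1 / 2) (hc : 0 < c)
    (hD : ∀ A B : ℤ, A ≠ 0 → c ≤ |(A : ℝ)| ^ κ * |A * x - B|) :
    Summable fun j => orbitProd x j ^ (s - 1 / 2) * (√|Tmap^[j] x|)⁻¹ := by
  obtain ⟨η, hηs⟩ : ∃ η, η = s + 1 / 2 - κ := ⟨_, rfl⟩
  have hη : 0 < η := by linarith
  have h0 : (0 : ℝ) < 1 - (1 / 2) ^ η := by
    have := Real.rpow_lt_one (x := 1 / 2) (by norm_num) (by norm_num) hη
    linarith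
  have hp := orbitProd_pos hx
  refine summable_of_le_mul_sub (g := fun j => orbitProd x j ^ η)
    (C := max (2 * (2 ^ κ / c) / η) (√(2 ^ κ / c) / (1 - (1 / 2) ^ η)))
    (le_max_of_le_left (by positivity)) (fun j => ?_) (fun j => (Real.rpow_nonneg (hp j).le _))
    fun j => ?_
  · have := hp j
    positivity
  · obtain ⟨h1, h2⟩ := orbitProd_lower_bounds hx hx1 (zero_le_one.trans hκ) hD j
    have hX := abs_Tmap_iterate_lt_one hx hx1 j
    have hX0 := abs_pos.2 (irrational_Tmap_iterate hx j).ne_zero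
    have hmono : 0 ≤ orbitProd x j ^ η - orbitProd x (j + 1) ^ η := by
      rw [orbitProd_succ]
      exact sub_nonneg.2 (Real.rpow_le_rpow (mul_pos (hp j) hX0).le
        (mul_le_of_le_one_right (hp j).le hX.le) hη.le)
    rcases le_total (1 / 2) |Tmap^[j] x| with h | h
    · refine le_trans ?_ (mul_le_mul_of_nonneg_right (le_max_left _ _) hmono)
      rw [orbitProd_succ]
      exact rpow_mul_inv_sqrt_le_of_half_le (hp j) h hX hη (by linarith) hηs hc h1
    · refine le_trans ?_ (mul_le_mul_of_nonneg_right (le_max_right _ _) hmono)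
      rw [orbitProd_succ]
      exact rpow_mul_inv_sqrt_le_of_le_half (hp j) (orbitProd_le_one hx hx1 j) hX0 h hκ hη hηs hc
        (h2 h)

lemma not_terminatedAt_of_irrational {x : ℝ} (hx : Irrational x) (n : ℕ) :
    ¬ (GenContFract.of x).TerminatedAt n := fun h => by
  obtain ⟨q, hq⟩ := GenContFract.exists_rat_eq_of_terminates ⟨n, h⟩
  exact hx ⟨q, hq.symm⟩

lemma exists_partDen_eq_intCast {x : ℝ} (hx : Irrational x) (n : ℕ) :
    ∃ (gp : GenContFract.Pair ℝ) (b : ℤ),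
      (GenContFract.of x).s.get? n = some gp ∧ gp.a = 1 ∧ gp.b = b := by
  obtain ⟨gp, hgp⟩ := Option.ne_none_iff_exists'.1 (not_terminatedAt_of_irrational hx n)
  obtain ⟨h1, b, h2⟩ := GenContFract.of_partNum_eq_one_and_exists_int_partDen_eq hgp
  exact ⟨gp, b, hgp, h1, h2⟩

lemma exists_nums_dens_eq_intCast {x : ℝ} (hx : Irrational x) (n : ℕ) :
    ∃ P Q : ℤ, (GenContFract.of x).nums n = P ∧ (GenContFract.of x).dens n = Q := by
  induction n using Nat.twoStepInduction with
  | zero =>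
    exact ⟨⌊x⌋, 1, by simp [GenContFract.zeroth_num_eq_h, GenContFract.of_h_eq_floor], by simp⟩
  | one =>
    obtain ⟨gp, b, hgp, ha, hb⟩ := exists_partDen_eq_intCast hx 0
    refine ⟨b * ⌊x⌋ + 1, b, ?_, ?_⟩
    · rw [GenContFract.first_num_eq hgp, ha, hb, GenContFract.of_h_eq_floor]
      push_cast; ring
    · rw [GenContFract.first_den_eq hgp, hb]
  | more n ih1 ih2 =>
    obtain ⟨gp, b, hgp, ha, hb⟩ := exists_partDen_eq_intCast hx (n + 1)
    obtain ⟨P, Q, hP, hQ⟩ := ih1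
    obtain ⟨P', Q', hP', hQ'⟩ := ih2
    refine ⟨b * P' + P, b * Q' + Q, ?_, ?_⟩
    · rw [GenContFract.nums_recurrence hgp hP hP', ha, hb]; push_cast; ring
    · rw [GenContFract.dens_recurrence hgp hQ hQ', ha, hb]; push_cast; ring

lemma Qden_zero (x : ℝ) : Qden x 0 = 1 := by simp [Qden]

lemma Qden_mono (x : ℝ) : Monotone (Qden x) :=
  monotone_nat_of_le_succ fun _ => GenContFract.of_den_mono

lemma one_le_Qden (x : ℝ) (n : ℕ) : 1 ≤ Qden x n := by
  simpa [Qden_zero] using Qden_mono x (Nat.zero_le n)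

lemma fib_succ_le_Qden {x : ℝ} (hx : Irrational x) (n : ℕ) : (Nat.fib (n + 1) : ℝ) ≤ Qden x n :=
  GenContFract.succ_nth_fib_le_of_nth_den (.inr (not_terminatedAt_of_irrational hx _))

lemma three_halves_pow_le_fib (n : ℕ) : (3 / 2 : ℝ) ^ n ≤ Nat.fib (n + 2) := by
  induction n using Nat.twoStepInduction with
  | zero => norm_num
  | one => norm_num [Nat.fib]
  | more n ih1 ih2 =>
    rw [Nat.fib_add_two, Nat.cast_add, pow_add]
    rw [pow_succ] at ih2
    rw [add_right_comm] at ih2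
    have : (0 : ℝ) < (3 / 2) ^ n := by positivity
    linarith

lemma three_halves_pow_le_Qden {x : ℝ} (hx : Irrational x) (n : ℕ) :
    (3 / 2 : ℝ) ^ n ≤ Qden x (n + 1) :=
  (three_halves_pow_le_fib n).trans (fib_succ_le_Qden hx (n + 1))

lemma tendsto_Qden_succ {x : ℝ} (hx : Irrational x) :
    Tendsto (fun n => Qden x (n + 1)) atTop atTop :=
  tendsto_atTop_mono (three_halves_pow_le_Qden hx)
    (tendsto_pow_atTop_atTop_of_one_lt (by norm_num))

/-- The convergents of an irrational number, with integral numerator and denominator. -/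
lemma exists_convergent {x : ℝ} (hx : Irrational x) (n : ℕ) :
    ∃ P Q : ℤ, Qden x n = Q ∧ IsCoprime Q P ∧ |Q * x - P| ≤ 1 / Qden x (n + 1) := by
  obtain ⟨P, Q, hP, hQ⟩ := exists_nums_dens_eq_intCast hx n
  obtain ⟨P', Q', hP', hQ'⟩ := exists_nums_dens_eq_intCast hx (n + 1)
  refine ⟨P, Q, hQ, ?_, ?_⟩
  · have h : P * Q' - Q * P' = (-1) ^ (n + 1) := by
      have := SimpContFract.determinant (s := SimpContFract.of x) (n := n)
        (not_terminatedAt_of_irrational hx n)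
      have e : (SimpContFract.of x : GenContFract ℝ) = GenContFract.of x := rfl
      rw [e, hP, hQ, hP', hQ'] at this
      exact_mod_cast this
    rcases neg_one_pow_eq_or ℤ (n + 1) with h1 | h1 <;> rw [h1] at h
    · exact ⟨-P', Q', by linarith⟩
    · exact ⟨P', -Q', by linarith⟩
  · have h := GenContFract.abs_sub_convs_le (not_terminatedAt_of_irrational hx n)
    have hQ1 : (1 : ℝ) ≤ Q := hQ ▸ one_le_Qden x n
    have hQ0 : (0 : ℝ) < Q := by linarith
    rw [GenContFract.conv_eq_num_div_den, hP, hQ] at h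
    change _ ≤ 1 / ((Q : ℝ) * Qden x (n + 1)) at h
    have e : (Q : ℝ) * x - P = Q * (x - P / Q) := by field_simp
    rw [e, abs_mul, abs_of_pos hQ0]
    calc (Q : ℝ) * |x - P / Q| ≤ Q * (1 / (Q * Qden x (n + 1))) := by gcongr
      _ = _ := by field_simp

lemma exists_lower_bound_of_Qden_le {x K κ : ℝ} (hx : Irrational x) (hκ : 0 ≤ κ)
    (h : ∀ n, Qden x (n + 2) ≤ K * Qden x (n + 1) ^ κ) :
    ∃ c > 0, ∀ A B : ℤ, A ≠ 0 → c ≤ |(A : ℝ)| ^ κ * |A * x - B| := by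
  set K' := max K (Qden x 1) with hK'
  have hK1 : 1 ≤ K' := (one_le_Qden x 1).trans (le_max_right _ _)
  refine ⟨1 / (2 * K' * 2 ^ κ), by positivity, fun A B hA => ?_⟩
  have ha1 : 1 ≤ |(A : ℝ)| := by exact_mod_cast Int.one_le_abs hA
  have hex : ∃ m, 2 * |(A : ℝ)| ≤ Qden x m := by
    obtain ⟨n, hn⟩ := ((tendsto_Qden_succ hx).eventually_ge_atTop (2 * |(A : ℝ)|)).exists
    exact ⟨_, hn⟩
  classical
  obtain ⟨m, hm, hmin⟩ : ∃ m, 2 * |(A : ℝ)| ≤ Qden x m ∧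
      ∀ n < m, Qden x n < 2 * |(A : ℝ)| :=
    ⟨Nat.find hex, Nat.find_spec hex, fun n hn => not_le.1 (Nat.find_min hex hn)⟩
  have hQm : Qden x m ≤ K' * (2 * |(A : ℝ)|) ^ κ := by
    match m, hm, hmin with
    | 0, hm, _ => rw [Qden_zero] at hm; linarith
    | 1, _, _ =>
      exact (le_max_right _ _).trans
        (le_mul_of_one_le_right (by linarith) (Real.one_le_rpow (by linarith) hκ))
    | n + 2, _, hmin =>
      have h0 := one_le_Qden x (n + 1)
      refine (h n).trans (mul_le_mul (le_max_left _ _) ?_ (by positivity) (by positivity))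
      exact Real.rpow_le_rpow (by linarith) (hmin (n + 1) (by lia)).le hκ
  obtain ⟨P, Q, hQ, hcop, happrox⟩ := exists_convergent hx m
  have hQ1 : (1 : ℝ) ≤ Q := hQ ▸ one_le_Qden x m
  have hne : A * P - B * Q ≠ 0 := by
    intro h0
    have hdvd : Q ∣ A := hcop.dvd_of_dvd_mul_right ⟨B, by linarith⟩
    have h1 : (Q : ℝ) ≤ |(A : ℝ)| := by
      exact_mod_cast Int.le_of_dvd (abs_pos.2 hA) ((dvd_abs _ _).2 hdvd)
    linarith
  have h1 : (1 : ℝ) ≤ |(A : ℝ) * P - B * Q| := by exact_mod_cast Int.one_le_abs hne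
  have h2 : |(A : ℝ)| * |Q * x - P| ≤ 1 / 2 := by
    have h3 := Qden_mono x m.le_succ
    calc |(A : ℝ)| * |Q * x - P| ≤ |(A : ℝ)| * (1 / Qden x (m + 1)) := by gcongr
      _ ≤ |(A : ℝ)| * (1 / (2 * |(A : ℝ)|)) := by gcongr; exact hm.trans h3
      _ = 1 / 2 := by field_simp
  have h4 : 1 / 2 ≤ Q * |(A : ℝ) * x - B| := by
    have h5 := abs_sub_abs_le_abs_sub ((A : ℝ) * P - B * Q) (-(A * (Q * x - P)))
    have e : (A : ℝ) * P - B * Q - -(A * (Q * x - P)) = Q * (A * x - B) := by ring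
    rw [e, abs_neg, abs_mul, abs_mul, abs_of_pos (by linarith : (0 : ℝ) < Q)] at h5
    linarith
  have h6 : (1 : ℝ) / 2 ≤ K' * (2 * |(A : ℝ)|) ^ κ * |(A : ℝ) * x - B| :=
    h4.trans (mul_le_mul_of_nonneg_right (hQ ▸ hQm) (abs_nonneg _))
  rw [Real.mul_rpow two_pos.le (abs_nonneg _)] at h6
  rw [div_le_iff₀ (by positivity)]
  linarith

lemma exists_Qden_le_of_summable {x a b : ℝ} (ha : 0 < a)
    (h : Summable fun n : ℕ => Qden x (n + 2) ^ a / Qden x (n + 1) ^ b) :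
    ∃ K, ∀ n, Qden x (n + 2) ≤ K * Qden x (n + 1) ^ (b / a) := by
  have hQ (n : ℕ) : 0 < Qden x n := zero_lt_one.trans_le (one_le_Qden x n)
  have hpos (n : ℕ) : 0 ≤ Qden x (n + 2) ^ a / Qden x (n + 1) ^ b := by
    have h1 := hQ (n + 1)
    have h2 := hQ (n + 2)
    positivity
  set M := ∑' n : ℕ, Qden x (n + 2) ^ a / Qden x (n + 1) ^ b
  have hM : 0 ≤ M := tsum_nonneg hpos
  refine ⟨M ^ a⁻¹, fun n => ?_⟩
  have h1 := h.le_tsum n fun m _ => hpos m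
  have h2 := hQ (n + 1)
  have h3 := hQ (n + 2)
  rw [div_le_iff₀ (by positivity)] at h1
  have h4 := Real.rpow_le_rpow (by positivity) h1 (inv_nonneg.2 ha.le)
  rwa [Real.rpow_rpow_inv h3.le ha.ne', Real.mul_rpow hM (by positivity), ← Real.rpow_mul h2.le,
    ← div_eq_mul_inv] at h4

lemma eventually_Qden_le_of_irrExp_lt {x μ : ℝ} (hx : Irrational x) (hμ : 1 ≤ μ)
    (h : irrExp x < μ) : ∀ᶠ n in atTop, Qden x (n + 2) ≤ Qden x (n + 1) ^ (μ - 1) := by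
  have hfin : {q : ℕ | 1 ≤ q ∧ ∃ p : ℤ, |x - (p : ℝ) / (q : ℝ)| < 1 / (q : ℝ) ^ μ}.Finite := by
    by_contra hinf
    have hle : (μ : EReal) ≤ irrExp x := le_sSup ⟨μ, rfl, hμ, hinf⟩
    exact hle.not_gt h
  obtain ⟨M, hM⟩ := hfin.bddAbove
  filter_upwards [(tendsto_Qden_succ hx).eventually_gt_atTop (M : ℝ)] with n hn
  obtain ⟨P, Q, hQ, -, happrox⟩ := exists_convergent hx (n + 1)
  have hQ1 : (1 : ℝ) ≤ Q := hQ ▸ one_le_Qden x (n + 1)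
  have hQ0 : (0 : ℝ) < Q := by linarith
  have hQ2 := one_le_Qden x (n + 2)
  lift Q to ℕ using by exact_mod_cast hQ0.le
  rw [Int.cast_natCast] at hQ hQ0 hQ1 happrox
  have h1 : 1 / (Q : ℝ) ^ μ ≤ |x - P / Q| := by
    by_contra! hlt
    have := hM ⟨by exact_mod_cast hQ1, P, hlt⟩
    rw [hQ] at hn
    exact absurd (Nat.cast_le.2 this) hn.not_ge
  have h2 : (Q : ℝ) * |x - P / Q| ≤ 1 / Qden x (n + 2) := by
    have e : (Q : ℝ) * x - P = Q * (x - P / Q) := by field_simp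
    rwa [e, abs_mul, abs_of_pos hQ0] at happrox
  have h3 := (mul_le_mul_of_nonneg_left h1 hQ0.le).trans h2
  rw [mul_one_div, div_le_div_iff₀ (by positivity) (by linarith)] at h3
  rw [hQ, Real.rpow_sub_one hQ0.ne', le_div_iff₀ hQ0]
  linarith

lemma summable_Qden_rpow_neg {x δ : ℝ} (hx : Irrational x) (hδ : 0 < δ) :
    Summable fun n => Qden x (n + 1) ^ (-δ) := by
  have hgeom : Summable fun n : ℕ => ((3 / 2 : ℝ) ^ (-δ)) ^ n :=
    summable_geometric_of_lt_one (by positivity)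
      (Real.rpow_lt_one_of_one_lt_of_neg (by norm_num) (neg_lt_zero.2 hδ))
  refine .of_nonneg_of_le (fun n => ?_) (fun n => ?_) hgeom
  · exact Real.rpow_nonneg (zero_le_one.trans (one_le_Qden x _)) _
  · rw [← Real.rpow_natCast, ← Real.rpow_mul (by norm_num), mul_comm, Real.rpow_mul (by norm_num),
      Real.rpow_natCast]
    exact Real.rpow_le_rpow_of_nonpos (by positivity) (three_halves_pow_le_Qden hx n)
      (neg_nonpos.2 hδ.le)

lemma summable_Qden_of_irrExp_lt {x a b : ℝ} (hx : Irrational x) (ha : 0 < a) (hb : 0 < b)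
    (h : irrExp x < ((1 + b / a : ℝ) : EReal)) :
    Summable fun n : ℕ => Qden x (n + 2) ^ a / Qden x (n + 1) ^ b := by
  obtain ⟨ν, hν1, hν2⟩ := EReal.lt_iff_exists_real_btwn.1 h
  have hμ : max ν 1 < 1 + b / a :=
    max_lt (EReal.coe_lt_coe_iff.1 hν2) (lt_add_of_pos_right _ (by positivity))
  have hlt : irrExp x < (max ν 1 : ℝ) := hν1.trans_le (EReal.coe_le_coe_iff.2 (le_max_left _ _))
  have hδ : 0 < b - (max ν 1 - 1) * a := by
    rw [← sub_lt_iff_lt_add', lt_div_iff₀ ha] at hμ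
    linarith
  refine Summable.of_norm_bounded_eventually_nat (summable_Qden_rpow_neg hx hδ) ?_
  filter_upwards [eventually_Qden_le_of_irrExp_lt hx (le_max_right _ _) hlt] with n hn
  have h1 : 0 < Qden x (n + 1) := zero_lt_one.trans_le (one_le_Qden x _)
  have h2 : 0 < Qden x (n + 2) := zero_lt_one.trans_le (one_le_Qden x _)
  rw [Real.norm_of_nonneg (by positivity), div_le_iff₀ (by positivity), ← Real.rpow_add h1]
  calc Qden x (n + 2) ^ a ≤ (Qden x (n + 1) ^ (max ν 1 - 1)) ^ a := by gcongr
    _ = _ := by rw [← Real.rpow_mul h1.le]; congr 1; ring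

/-- identity for `F_s(x)` under `Σ Q_{n+1}^{(3-s)/2}/Q_n^{1+s/2} < ∞`, and this
condition holds whenever `μ(x) < 1 + (2+s)/(3-s)`. -/
theorem stmt15 (s : ℝ) (hs1 : 1 / 2 < s) (hs2 : s < 1)
    (x : ℝ) (hx : x ∈ Set.Ioo (0 : ℝ) 1) (hirr : Irrational x) :
    (Summable (fun n : ℕ => Qden x (n + 2) ^ ((3 - s) / 2) / Qden x (n + 1) ^ (1 + s / 2)) →
      ∃ L : ℂ, Tendsto (fun n : ℕ => Fpart s n x 0) atTop (𝓝 L) ∧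
        HasSum (fun j : ℕ =>
          Complex.exp (Real.pi * Complex.I / 4
              * ((∑ ℓ ∈ Finset.range j, Real.sign (Tmap^[ℓ] x) : ℝ) : ℂ))
            * (((∏ ℓ ∈ Finset.range j, |Tmap^[ℓ] x|) ^ (s - 1 / 2) : ℝ) : ℂ)
            * Omega0 s (Tmap^[j] x)) L) ∧
    (irrExp x < ((1 + (2 + s) / (3 - s) : ℝ) : EReal) →
      Summable (fun n : ℕ => Qden x (n + 2) ^ ((3 - s) / 2) / Qden x (n + 1) ^ (1 + s / 2))) := by
  have h3 : 0 < 3 - s := by linarith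
  have hκ : (1 + s / 2) / ((3 - s) / 2) = (2 + s) / (3 - s) := by field_simp
  constructor
  · intro h
    obtain ⟨K, hK⟩ := exists_Qden_le_of_summable (by linarith) h
    rw [hκ] at hK
    have hκ1 : 1 ≤ (2 + s) / (3 - s) := by rw [le_div_iff₀ h3]; linarith
    have hκ2 : (2 + s) / (3 - s) < s + 1 / 2 := by rw [div_lt_iff₀ h3]; nlinarith
    obtain ⟨c, hc, hD⟩ := exists_lower_bound_of_Qden_le hirr (zero_le_one.trans hκ1) hK
    have hx1 : |x| ≤ 1 := by rw [abs_of_pos hx.1]; exact hx.2.le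
    exact tendsto_Fpart_of_summable hs1 hs2.le hirr hx1
      (summable_orbit hirr hx1 hs2.le hκ1 hκ2 hc hD)
  · intro h
    exact summable_Qden_of_irrExp_lt hirr (by linarith) (by linarith) (by rwa [hκ])
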